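/- arXiv:2210.06415 — 2 statements merged into one kernel-verified Lean document; each statement's English description precedes it below -/
import Mathlib

section
/- (i) Let a > 0, n ∈ ℤ with n ≥ 2, and 0 < h < a, and let [Δ, ((a,h)), (+1)] be the minimal semitoric polygon of type (3b): Δ has vertices (0,0), (a,a), (na,0), with marked point (a,h) and upward cut. Then the semitoric packing density is ρ_ST = 2/n, independent of h. (ii) Let a > 0, −a < b < 0, n ∈ ℤ with n ≥ 2, and 0 < h < a + b/(n−1), and let [Δ, ((a,h)), (+1)] be the minimal semitoric polygon of type (3c): Δ has vertices (0,0), (a+b,a+b), (a, a + b/(n−1)), (na+b,0), with marked point (a,h) and upward cut. Then ρ_ST = ((a+b)² + min(((n−1)a + b − (n−2)h)², a²)) / ((na+2b)a). -/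
open Matrix MeasureTheory Set

/-- Points of the plane. -/
abbrev Pt := Fin 2 → ℝ

/-- The action of `SL₂(ℤ)` on `ℝ²` by matrix-vector multiplication. -/
noncomputable def sl2Apply (M : Matrix.SpecialLinearGroup (Fin 2) ℤ) (x : Pt) : Pt :=
  ((M : Matrix (Fin 2) (Fin 2) ℤ).map (Int.cast : ℤ → ℝ)).mulVec x

/-- The model triangle `B(λ) = {(x,y) : x ≥ 0, y ≥ 0, x + y < λ}`. -/
def modelTriangle (lam : ℝ) : Set Pt :=
  {x | 0 ≤ x 0 ∧ 0 ≤ x 1 ∧ x 0 + x 1 < lam}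

/-- The area (Lebesgue measure) of a subset of the plane. -/
noncomputable def area (S : Set Pt) : ℝ := (volume S).toReal

/-- The element of the group `𝒯 × G_m` determined by a global power `n` of
`T = [[1,0],[1,1]]`, a vertical translation `t`, and cut flips `u` (with `u j ∈ {0, ε_j}`;
flipping the cut at the marked point `c j` applies `T^{± 1}` on the half-plane to its
right), as a piecewise affine map of the plane. -/
noncomputable def stMap {m : ℕ} (c : Fin m → Pt) (n : ℤ) (t : ℝ) (u : Fin m → ℤ)
    (x : Pt) : Pt :=
  ![x 0, x 1 + (n : ℝ) * x 0 + t + ∑ j, (u j : ℝ) * max (x 0 - c j 0) 0]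

/-- `B` is an admissibly packed triangle of `SL₂(ℤ)`-size `lam` at the point `p` of the
semitoric polygon with underlying set `Δ`, marked points `c` and cut directions `eps`:
in some equivalent representative (image under an element `σ` of `𝒯 × G_m`), `σ(B)` has
the form `M(B(lam)) + σ(p)` with `M ∈ SL₂(ℤ)`, coincides with the polygon near `σ(p)`,
and contains no marked point. -/
def IsSTPackedTriangleIn {m : ℕ} (Δ : Set Pt) (c : Fin m → Pt) (eps : Fin m → ℤ)
    (p : Pt) (lam : ℝ) (B : Set Pt) : Prop :=
  0 < lam ∧ B ⊆ Δ ∧ (∀ j, c j ∉ B) ∧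
  ∃ (n : ℤ) (t : ℝ) (u : Fin m → ℤ), (∀ j, u j = 0 ∨ u j = eps j) ∧
    (∃ M : Matrix.SpecialLinearGroup (Fin 2) ℤ,
        stMap c n t u '' B =
          (fun x => sl2Apply M x + stMap c n t u p) '' modelTriangle lam) ∧
    ∃ U : Set Pt, IsOpen U ∧ stMap c n t u p ∈ U ∧
      (stMap c n t u '' B) ∩ U = (stMap c n t u '' Δ) ∩ U

/-- `P` is a semitoric packing of the semitoric polygon `(Δ, c, eps)`: a finite union of
pairwise disjoint admissibly packed triangles, at most one at each vertex. -/
def IsSTPackingIn {m : ℕ} (Δ : Set Pt) (c : Fin m → Pt) (eps : Fin m → ℤ)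
    (P : Set Pt) : Prop :=
  ∃ (N : ℕ) (pt : Fin N → Pt) (lam : Fin N → ℝ) (tri : Fin N → Set Pt),
    P = (⋃ a, tri a) ∧ Function.Injective pt ∧
    (∀ a, pt a ∈ Set.extremePoints ℝ Δ) ∧
    (∀ a, IsSTPackedTriangleIn Δ c eps (pt a) (lam a) (tri a)) ∧
    Pairwise (Function.onFun Disjoint tri)

/-- The set of densities `area P / area Δ` of semitoric packings `P` of `(Δ, c, eps)`;
the semitoric packing density `ρ_ST` is its supremum. -/
def stDensitySet {m : ℕ} (Δ : Set Pt) (c : Fin m → Pt) (eps : Fin m → ℤ) : Set ℝ :=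
  {r : ℝ | ∃ P, IsSTPackingIn Δ c eps P ∧ r = area P / area Δ}

/-- The vertical displacement of `z` from `p`, measured in the representative obtained by
flipping the cut on the line `x = a` when `u = 1`. -/
noncomputable def flipHeight (a : ℝ) (u : ℤ) (p z : Pt) : ℝ :=
  z 1 - p 1 + u * (max (z 0 - a) 0 - max (p 0 - a) 0)

/-- `S` is the triangle of size `lam` at `p` whose barycentric coordinates, in the
representative flipped by `u`, are given by the unimodular matrix `[[A, B], [C, D]]`, and `S`
agrees with `Δ` near `p`. -/
def IsCornerChart (Δ : Set Pt) (a : ℝ) (u A B C D : ℤ) (p : Pt) (lam : ℝ) (S : Set Pt) :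
    Prop :=
  A * D - B * C = 1 ∧
  (∀ z, z ∈ S ↔ 0 ≤ A * (z 0 - p 0) + B * flipHeight a u p z ∧
    0 ≤ C * (z 0 - p 0) + D * flipHeight a u p z ∧
    (A * (z 0 - p 0) + B * flipHeight a u p z) +
      (C * (z 0 - p 0) + D * flipHeight a u p z) < lam) ∧
  ∃ V : Set Pt, IsOpen V ∧ p ∈ V ∧ ∀ z ∈ V, (z ∈ S ↔ z ∈ Δ)

/-- The ray from `p` which is straight with direction `e` in the representative flipped
by `u`. -/
noncomputable def flipRay (a : ℝ) (u : ℤ) (p : Pt) (e0 e1 : ℤ) (s : ℝ) : Pt :=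
  ![p 0 + s * e0, p 1 + s * e1 - u * (max (p 0 + s * e0 - a) 0 - max (p 0 - a) 0)]

theorem stMap_one (a h : ℝ) (k : ℤ) (t : ℝ) (u : Fin 1 → ℤ) (x : Pt) :
    stMap (![![a, h]] : Fin 1 → Pt) k t u x =
      ![x 0, x 1 + k * x 0 + t + u 0 * max (x 0 - a) 0] := by
  simp [stMap]

theorem stMap_one_injective (a h : ℝ) (k : ℤ) (t : ℝ) (u : Fin 1 → ℤ) :
    Function.Injective (stMap (![![a, h]] : Fin 1 → Pt) k t u) := by
  intro x y hxy
  rw [stMap_one, stMap_one] at hxy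
  have h0 := congrFun hxy 0
  have h1 := congrFun hxy 1
  simp only [cons_val_zero, cons_val_one] at h0 h1
  rw [h0] at h1
  ext i
  fin_cases i
  · exact h0
  · simpa using h1

theorem continuous_stMap_one (a h : ℝ) (k : ℤ) (t : ℝ) (u : Fin 1 → ℤ) :
    Continuous (stMap (![![a, h]] : Fin 1 → Pt) k t u) := by
  have : stMap (![![a, h]] : Fin 1 → Pt) k t u =
      fun x => ![x 0, x 1 + k * x 0 + t + u 0 * max (x 0 - a) 0] :=
    funext (stMap_one a h k t u)
  rw [this]
  refine continuous_pi fun i => ?_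
  fin_cases i
  · simpa using continuous_apply 0
  · simp only [Fin.mk_one, cons_val_one]
    fun_prop

theorem sl2Apply_eq (M : Matrix.SpecialLinearGroup (Fin 2) ℤ) (x : Pt) :
    sl2Apply M x =
      ![(M 0 0 : ℝ) * x 0 + M 0 1 * x 1, (M 1 0 : ℝ) * x 0 + M 1 1 * x 1] := by
  ext i
  fin_cases i <;> simp [sl2Apply, Matrix.mulVec, dotProduct, Fin.sum_univ_two]

theorem IsSTPackedTriangleIn.exists_chart {Δ : Set Pt} {a h : ℝ} {p : Pt} {lam : ℝ}
    {S : Set Pt}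
    (H : IsSTPackedTriangleIn Δ (![![a, h]] : Fin 1 → Pt) (![1] : Fin 1 → ℤ) p lam S) :
    ∃ u A B C D : ℤ, (u = 0 ∨ u = 1) ∧ IsCornerChart Δ a u A B C D p lam S := by
  obtain ⟨-, -, -, k, t, u, hu, ⟨M, hM⟩, U, hU, hpU, hloc⟩ := H
  have hinj := stMap_one_injective a h k t u
  have hdet : M 0 0 * M 1 1 - M 0 1 * M 1 0 = 1 := by
    have := M.det_coe
    rwa [Matrix.det_fin_two] at this
  have hdetR : (M 0 0 : ℝ) * M 1 1 - M 0 1 * M 1 0 = 1 := by exact_mod_cast hdet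
  refine ⟨u 0, M 1 1 - k * M 0 1, -M 0 1, -M 1 0 + k * M 0 0, M 0 0, by simpa using hu 0,
    ?_, fun z => ?_, stMap _ k t u ⁻¹' U, hU.preimage (continuous_stMap_one a h k t u), hpU,
    fun z hz => ?_⟩
  · linear_combination hdet
  · rw [← hinj.mem_set_image, hM]
    constructor
    · rintro ⟨x, ⟨hx0, hx1, hx2⟩, hx⟩
      simp only [sl2Apply_eq, stMap_one] at hx
      have h0 := congrFun hx 0
      have h1 := congrFun hx 1
      simp only [Pi.add_apply, cons_val_zero, cons_val_one] at h0 h1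
      have e1 : ((M 1 1 - k * M 0 1 : ℤ) : ℝ) * (z 0 - p 0) +
          ((-M 0 1 : ℤ) : ℝ) * flipHeight a (u 0) p z = x 0 := by
        simp only [flipHeight]
        push_cast
        linear_combination (-M 1 1 : ℝ) * h0 + (M 0 1 : ℝ) * h1 + x 0 * hdetR
      have e2 : ((-M 1 0 + k * M 0 0 : ℤ) : ℝ) * (z 0 - p 0) +
          ((M 0 0 : ℤ) : ℝ) * flipHeight a (u 0) p z = x 1 := by
        simp only [flipHeight]
        push_cast
        linear_combination (M 1 0 : ℝ) * h0 - (M 0 0 : ℝ) * h1 + x 1 * hdetR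
      rw [e1, e2]
      exact ⟨hx0, hx1, hx2⟩
    · intro hz
      refine ⟨![_, _], ⟨hz.1, hz.2.1, hz.2.2⟩, ?_⟩
      simp only [sl2Apply_eq, stMap_one, flipHeight]
      ext i
      fin_cases i
      · simp
        linear_combination (z 0 - p 0) * hdetR
      · simp
        linear_combination (z 1 - p 1 + k * (z 0 - p 0) +
          u 0 * (max (z 0 - a) 0 - max (p 0 - a) 0)) * hdetR
  · have h1 : stMap (![![a, h]] : Fin 1 → Pt) k t u z ∈ U := hz
    have h2 := Set.ext_iff.1 hloc (stMap ![![a, h]] k t u z)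
    simpa only [Set.mem_inter_iff, h1, and_true, hinj.mem_set_image] using h2

/-- A corner chart yields an admissibly packed triangle. -/
theorem IsCornerChart.isSTPackedTriangleIn {Δ : Set Pt} {a h : ℝ} {u A B C D : ℤ}
    {p : Pt} {lam : ℝ} {S : Set Pt} (H : IsCornerChart Δ a u A B C D p lam S)
    (hu : u = 0 ∨ u = 1) (hlam : 0 < lam) (hS : S ⊆ Δ) (hc : ![a, h] ∉ S) :
    IsSTPackedTriangleIn Δ (![![a, h]] : Fin 1 → Pt) (![1] : Fin 1 → ℤ) p lam S := by
  obtain ⟨hdet, hmem, V, hV, hpV, hloc⟩ := H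
  have hdetR : (A : ℝ) * D - B * C = 1 := by exact_mod_cast hdet
  obtain ⟨M, h00, h01, h10, h11⟩ : ∃ M : Matrix.SpecialLinearGroup (Fin 2) ℤ,
      M 0 0 = D ∧ M 0 1 = -B ∧ M 1 0 = -C ∧ M 1 1 = A :=
    ⟨⟨!![D, -B; -C, A], by rw [Matrix.det_fin_two_of]; linear_combination hdet⟩,
      rfl, rfl, rfl, rfl⟩
  have hinv : ∀ z, stMap (![![a, h]] : Fin 1 → Pt) 0 0 (fun _ => -u)
      (stMap (![![a, h]] : Fin 1 → Pt) 0 0 (fun _ => u) z) = z := by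
    intro z
    simp only [stMap_one]
    ext i
    fin_cases i <;> simp
  refine ⟨hlam, hS, fun j => by fin_cases j; exact hc, 0, 0, fun _ => u,
    fun j => by fin_cases j; simpa using hu,
    ⟨M, ?_⟩, stMap (![![a, h]] : Fin 1 → Pt) 0 0 (fun _ => -u) ⁻¹' V,
    hV.preimage (continuous_stMap_one a h 0 0 _), ?_, ?_⟩
  · ext w
    constructor
    · rintro ⟨z, hz, rfl⟩
      have hz' := (hmem z).1 hz
      refine ⟨![_, _], ⟨hz'.1, hz'.2.1, hz'.2.2⟩, ?_⟩
      simp only [sl2Apply_eq, h00, h01, h10, h11, stMap_one, flipHeight]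
      ext i
      fin_cases i
      · simp
        linear_combination (z 0 - p 0) * hdetR
      · simp
        linear_combination (z 1 - p 1 +
          u * (max (z 0 - a) 0 - max (p 0 - a) 0)) * hdetR
    · rintro ⟨x, ⟨hx0, hx1, hx2⟩, rfl⟩
      set w : Pt := sl2Apply M x + stMap (![![a, h]] : Fin 1 → Pt) 0 0 (fun _ => u) p with hw
      have hw0 : w 0 = D * x 0 - B * x 1 + p 0 := by
        rw [hw]
        simp [sl2Apply_eq, h00, h01, h10, h11, stMap_one]
        ring
      have hw1 : w 1 = -C * x 0 + A * x 1 + (p 1 + u * max (p 0 - a) 0) := by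
        rw [hw]
        simp [sl2Apply_eq, h00, h01, h10, h11, stMap_one]
      refine ⟨![w 0, w 1 - u * max (w 0 - a) 0], ?_, ?_⟩
      · rw [hmem]
        have e1 : (A : ℝ) * ((![w 0, w 1 - u * max (w 0 - a) 0] : Pt) 0 - p 0) +
            B * flipHeight a u p ![w 0, w 1 - u * max (w 0 - a) 0] = x 0 := by
          simp only [flipHeight, cons_val_zero, cons_val_one]
          linear_combination (A : ℝ) * hw0 + (B : ℝ) * hw1 + x 0 * hdetR
        have e2 : (C : ℝ) * ((![w 0, w 1 - u * max (w 0 - a) 0] : Pt) 0 - p 0) +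
            D * flipHeight a u p ![w 0, w 1 - u * max (w 0 - a) 0] = x 1 := by
          simp only [flipHeight, cons_val_zero, cons_val_one]
          linear_combination (C : ℝ) * hw0 + (D : ℝ) * hw1 + x 1 * hdetR
        rw [e1, e2]
        exact ⟨hx0, hx1, hx2⟩
      · change _ = w
        rw [stMap_one]
        ext i
        fin_cases i <;> simp
  · rwa [Set.mem_preimage, hinv]
  · ext w
    constructor
    · rintro ⟨⟨z, hz, rfl⟩, hw⟩
      rw [Set.mem_preimage, hinv] at hw
      refine ⟨⟨z, (hloc z hw).1 hz, rfl⟩, ?_⟩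
      rwa [Set.mem_preimage, hinv]
    · rintro ⟨⟨z, hz, rfl⟩, hw⟩
      rw [Set.mem_preimage, hinv] at hw
      refine ⟨⟨z, (hloc z hw).2 hz, rfl⟩, ?_⟩
      rwa [Set.mem_preimage, hinv]

theorem flipHeight_flipRay (a : ℝ) (u : ℤ) (p : Pt) (e0 e1 : ℤ) (s : ℝ) :
    flipHeight a u p (flipRay a u p e0 e1 s) = s * e1 := by
  simp only [flipHeight, flipRay, cons_val_zero, cons_val_one]
  ring

theorem flipRay_apply_zero_sub (a : ℝ) (u : ℤ) (p : Pt) (e0 e1 : ℤ) (s : ℝ) :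
    flipRay a u p e0 e1 s 0 - p 0 = s * e0 := by
  simp [flipRay]

theorem exists_flipRay_mem {V : Set Pt} (a : ℝ) (u : ℤ) {p : Pt} (e0 e1 : ℤ)
    (hV : IsOpen V) (hp : p ∈ V) {ε : ℝ} (hε : 0 < ε) :
    ∃ s, 0 < s ∧ s < ε ∧ flipRay a u p e0 e1 s ∈ V := by
  have hc : Continuous (flipRay a u p e0 e1) := by
    refine continuous_pi fun i => ?_
    fin_cases i
    · simp only [flipRay, Fin.zero_eta, cons_val_zero]
      fun_prop
    · simp only [flipRay, Fin.mk_one, cons_val_one]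
      fun_prop
  have h0 : flipRay a u p e0 e1 0 = p := by
    ext i
    fin_cases i <;> simp [flipRay]
  have hopen : IsOpen (flipRay a u p e0 e1 ⁻¹' V) := hV.preimage hc
  obtain ⟨δ, hδ, hball⟩ := Metric.isOpen_iff.1 hopen 0 (by rwa [Set.mem_preimage, h0])
  refine ⟨min δ ε / 2, by positivity, ?_, hball ?_⟩
  · have := min_le_right δ ε
    linarith
  · have := min_le_left δ ε
    have h3 : 0 < min δ ε := lt_min hδ hε
    rw [Metric.mem_ball, Real.dist_eq, sub_zero, abs_of_pos (by positivity)]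
    linarith

theorem IsCornerChart.flipRay_mem_iff {Δ : Set Pt} {a : ℝ} {u A B C D : ℤ}
    {p : Pt} {lam : ℝ} {S : Set Pt} (H : IsCornerChart Δ a u A B C D p lam S)
    (e0 e1 : ℤ) (s : ℝ) :
    flipRay a u p e0 e1 s ∈ S ↔ 0 ≤ s * ((A * e0 + B * e1 : ℤ) : ℝ) ∧
      0 ≤ s * ((C * e0 + D * e1 : ℤ) : ℝ) ∧
      s * ((A * e0 + B * e1 : ℤ) : ℝ) + s * ((C * e0 + D * e1 : ℤ) : ℝ) < lam := by
  rw [H.2.1, flipHeight_flipRay, flipRay_apply_zero_sub]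
  push_cast
  ring_nf

/-- The two columns of the chart matrix satisfy the inequalities supporting `Δ` at `p`. -/
theorem IsCornerChart.columns_support {Δ : Set Pt} {a : ℝ} {u A B C D : ℤ}
    {p : Pt} {lam : ℝ} {S : Set Pt} (H : IsCornerChart Δ a u A B C D p lam S)
    (hlam : 0 < lam) {e0 e1 : ℤ}
    (hsup : ∀ z ∈ Δ, 0 ≤ (e0 : ℝ) * flipHeight a u p z - e1 * (z 0 - p 0)) :
    C * e0 + D * e1 ≤ 0 ∧ 0 ≤ A * e0 + B * e1 := by
  obtain ⟨hdet, -, V, hV, hpV, hloc⟩ := id H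
  constructor
  · obtain ⟨s, hs, hs', hsV⟩ := exists_flipRay_mem a u D (-C) hV hpV hlam
    have hmem : flipRay a u p D (-C) s ∈ S := by
      rw [H.flipRay_mem_iff, show A * D + B * -C = 1 by linear_combination hdet,
        show C * D + D * -C = 0 by ring]
      simp [hs.le, hs']
    have h1 := hsup _ ((hloc _ hsV).1 hmem)
    rw [flipHeight_flipRay, flipRay_apply_zero_sub] at h1
    have h2 : ((C * e0 + D * e1 : ℤ) : ℝ) ≤ 0 := by
      push_cast at h1 ⊢
      nlinarith
    exact_mod_cast h2
  · obtain ⟨s, hs, hs', hsV⟩ := exists_flipRay_mem a u (-B) A hV hpV hlam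
    have hmem : flipRay a u p (-B) A s ∈ S := by
      rw [H.flipRay_mem_iff, show A * -B + B * A = 0 by ring,
        show C * -B + D * A = 1 by linear_combination hdet]
      simp [hs.le, hs']
    have h1 := hsup _ ((hloc _ hsV).1 hmem)
    rw [flipHeight_flipRay, flipRay_apply_zero_sub] at h1
    have h2 : 0 ≤ ((A * e0 + B * e1 : ℤ) : ℝ) := by
      push_cast at h1 ⊢
      nlinarith
    exact_mod_cast h2

/-- Directions along which `Δ` contains a segment at `p` have nonnegative chart
coordinates. -/
theorem IsCornerChart.coord_nonneg {Δ : Set Pt} {a : ℝ} {u A B C D : ℤ}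
    {p : Pt} {lam : ℝ} {S : Set Pt} (H : IsCornerChart Δ a u A B C D p lam S)
    {e0 e1 : ℤ} {ε : ℝ} (hε : 0 < ε)
    (hin : ∀ s, 0 < s → s < ε → flipRay a u p e0 e1 s ∈ Δ) :
    0 ≤ A * e0 + B * e1 ∧ 0 ≤ C * e0 + D * e1 := by
  obtain ⟨-, -, V, hV, hpV, hloc⟩ := id H
  obtain ⟨s, hs, hs', hsV⟩ := exists_flipRay_mem a u e0 e1 hV hpV hε
  have h1 := (H.flipRay_mem_iff e0 e1 s).1 ((hloc _ hsV).2 (hin s hs hs'))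
  constructor
  · exact_mod_cast nonneg_of_mul_nonneg_right h1.1 hs
  · exact_mod_cast nonneg_of_mul_nonneg_right h1.2.1 hs

theorem coord_eq_one_of_isCoprime {A B C D e0 e1 : ℤ} (he : IsCoprime e0 e1)
    (hdet : A * D - B * C = 1) (h1 : 0 ≤ A * e0 + B * e1) (h2 : C * e0 + D * e1 = 0) :
    A * e0 + B * e1 = 1 := by
  obtain ⟨x, y, hxy⟩ := he
  have h3 : e0 = D * (A * e0 + B * e1) := by
    linear_combination (-e0) * hdet - B * h2
  have h4 : e1 = -C * (A * e0 + B * e1) := by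
    linear_combination (-e1) * hdet + A * h2
  have h5 : (A * e0 + B * e1) * (x * D - y * C) = 1 := by
    linear_combination hxy - x * h3 - y * h4
  rcases Int.isUnit_iff.1 (IsUnit.of_mul_eq_one _ h5) with h | h <;> omega

/-- An edge of `Δ` at `p` with `Δ` on its left is the first axis of the chart. -/
theorem IsCornerChart.left_edge {Δ : Set Pt} {a : ℝ} {u A B C D : ℤ}
    {p : Pt} {lam : ℝ} {S : Set Pt} (H : IsCornerChart Δ a u A B C D p lam S)
    (hlam : 0 < lam) {e0 e1 : ℤ} (he : IsCoprime e0 e1) {ε : ℝ} (hε : 0 < ε)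
    (hin : ∀ s, 0 < s → s < ε → flipRay a u p e0 e1 s ∈ Δ)
    (hsup : ∀ z ∈ Δ, 0 ≤ (e0 : ℝ) * flipHeight a u p z - e1 * (z 0 - p 0)) :
    A * e0 + B * e1 = 1 ∧ C * e0 + D * e1 = 0 := by
  have h1 := H.columns_support hlam hsup
  have h2 := H.coord_nonneg hε hin
  have h3 : C * e0 + D * e1 = 0 := le_antisymm h1.1 h2.2
  exact ⟨coord_eq_one_of_isCoprime he H.1 h2.1 h3, h3⟩

/-- An edge of `Δ` at `p` with `Δ` on its right is the second axis of the chart. -/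
theorem IsCornerChart.right_edge {Δ : Set Pt} {a : ℝ} {u A B C D : ℤ}
    {p : Pt} {lam : ℝ} {S : Set Pt} (H : IsCornerChart Δ a u A B C D p lam S)
    (hlam : 0 < lam) {e0 e1 : ℤ} (he : IsCoprime e0 e1) {ε : ℝ} (hε : 0 < ε)
    (hin : ∀ s, 0 < s → s < ε → flipRay a u p e0 e1 s ∈ Δ)
    (hsup : ∀ z ∈ Δ, (e0 : ℝ) * flipHeight a u p z - e1 * (z 0 - p 0) ≤ 0) :
    A * e0 + B * e1 = 0 ∧ C * e0 + D * e1 = 1 := by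
  have h1 := H.columns_support (e0 := -e0) (e1 := -e1) hlam
    (fun z hz => by have := hsup z hz; push_cast; linarith)
  have h2 := H.coord_nonneg hε hin
  have h3 : A * e0 + B * e1 = 0 := le_antisymm (by linarith [h1.2]) h2.1
  exact ⟨h3, coord_eq_one_of_isCoprime (A := C) (B := D) (C := -A) (D := -B) he
    (by linear_combination H.1) h2.2 (by linear_combination -h3)⟩

theorem volume_eq_lintegral_slice {S : Set Pt} (hS : MeasurableSet S) :
    volume S = ∫⁻ x : ℝ, volume {y : ℝ | (![x, y] : Pt) ∈ S} := by
  have h1 := (volume_preserving_finTwoArrow ℝ).symm.measure_preimage_equiv S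
  rw [← h1, Measure.volume_eq_prod,
    Measure.prod_apply ((MeasurableEquiv.finTwoArrow (α := ℝ)).symm.measurable hS)]
  rfl

theorem continuous_shear {f : ℝ → ℝ} (hf : Continuous f) :
    Continuous fun z : Pt => (![z 0, z 1 + f (z 0)] : Pt) := by
  refine continuous_pi fun i => ?_
  fin_cases i
  · simp only [Fin.zero_eta, cons_val_zero]
    fun_prop
  · simp only [Fin.mk_one, cons_val_one]
    fun_prop

theorem volume_preimage_shear {S : Set Pt} (hS : MeasurableSet S) {f : ℝ → ℝ}
    (hf : Continuous f) :
    volume {z : Pt | (![z 0, z 1 + f (z 0)] : Pt) ∈ S} = volume S := by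
  rw [volume_eq_lintegral_slice hS]
  refine (volume_eq_lintegral_slice ((continuous_shear hf).measurable hS)).trans ?_
  refine lintegral_congr fun x => ?_
  exact measure_preimage_add_right volume (f x) {y : ℝ | (![x, y] : Pt) ∈ S}

theorem measurableSet_modelTriangle (lam : ℝ) : MeasurableSet (modelTriangle lam) := by
  have h0 : Continuous fun x : Pt => x 0 := continuous_apply 0
  have h1 : Continuous fun x : Pt => x 1 := continuous_apply 1
  exact ((isClosed_le continuous_const h0).measurableSet).inter
    (((isClosed_le continuous_const h1).measurableSet).inter
      (isOpen_lt (h0.add h1) continuous_const).measurableSet)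

theorem volume_modelTriangle {lam : ℝ} (hlam : 0 ≤ lam) :
    volume (modelTriangle lam) = ENNReal.ofReal (lam ^ 2 / 2) := by
  rw [volume_eq_lintegral_slice (measurableSet_modelTriangle lam)]
  have h1 : ∀ x : ℝ, volume {y : ℝ | (![x, y] : Pt) ∈ modelTriangle lam} =
      (Icc 0 lam).indicator (fun x => ENNReal.ofReal (lam - x)) x := by
    intro x
    by_cases hx : x ∈ Icc 0 lam
    · rw [indicator_of_mem hx]
      have : {y : ℝ | (![x, y] : Pt) ∈ modelTriangle lam} = Ico 0 (lam - x) := by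
        ext y
        simp only [modelTriangle, mem_ofPred_eq, cons_val_zero, cons_val_one, mem_Ico]
        constructor
        · rintro ⟨-, h, h'⟩
          exact ⟨h, by linarith⟩
        · rintro ⟨h, h'⟩
          exact ⟨hx.1, h, by linarith⟩
      rw [this, Real.volume_Ico, sub_zero]
    · rw [indicator_of_notMem hx]
      have : {y : ℝ | (![x, y] : Pt) ∈ modelTriangle lam} = ∅ := by
        ext y
        simp only [modelTriangle, mem_ofPred_eq, cons_val_zero, cons_val_one,
          mem_empty_iff_false, iff_false]
        rintro ⟨h, h', h''⟩
        exact hx ⟨h, by linarith⟩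
      rw [this, measure_empty]
  simp_rw [h1]
  rw [lintegral_indicator measurableSet_Icc, ← ofReal_integral_eq_lintegral_ofReal,
    integral_Icc_eq_integral_Ioc, ← intervalIntegral.integral_of_le hlam]
  · congr 1
    rw [intervalIntegral.integral_sub intervalIntegrable_const
      intervalIntegral.intervalIntegrable_id, integral_id]
    simp
    ring
  · exact (continuous_const.sub continuous_id).integrableOn_Icc
  · filter_upwards [ae_restrict_mem measurableSet_Icc] with x hx
    simpa using hx.2

theorem IsCornerChart.measurableSet_and_area {Δ : Set Pt} {a : ℝ} {u A B C D : ℤ}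
    {p : Pt} {lam : ℝ} {S : Set Pt} (H : IsCornerChart Δ a u A B C D p lam S)
    (hlam : 0 ≤ lam) :
    MeasurableSet S ∧ volume S = ENNReal.ofReal (lam ^ 2 / 2) := by
  set L : Matrix (Fin 2) (Fin 2) ℝ := !![(A : ℝ), B; C, D] with hL
  have hdetL : LinearMap.det (Matrix.toLin' L) = 1 := by
    rw [LinearMap.det_toLin', hL, Matrix.det_fin_two_of]
    exact_mod_cast H.1
  set q : Pt := ![p 0, p 1 + u * max (p 0 - a) 0] with hq
  set R : Set Pt := Matrix.toLin' L ⁻¹' modelTriangle lam with hR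
  have hRm : MeasurableSet R :=
    (LinearMap.continuous_of_finiteDimensional _).measurable (measurableSet_modelTriangle lam)
  set R' : Set Pt := (fun z => z + -q) ⁻¹' R with hR'
  have hR'm : MeasurableSet R' := (measurable_id.add_const (-q)) hRm
  have hf : Continuous fun x : ℝ => (u : ℝ) * max (x - a) 0 := by fun_prop
  have hS : S = {z : Pt | (![z 0, z 1 + u * max (z 0 - a) 0] : Pt) ∈ R'} := by
    ext z
    rw [H.2.1, mem_ofPred_eq, hR', mem_preimage, hR, mem_preimage, modelTriangle, mem_ofPred_eq]
    simp [hL, hq, Matrix.mulVec, dotProduct, flipHeight]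
    ring_nf
  refine ⟨hS ▸ (continuous_shear hf).measurable hR'm, ?_⟩
  rw [hS, volume_preimage_shear hR'm hf, hR', measure_preimage_add_right, hR,
    Measure.addHaar_preimage_linearMap _ (by rw [hdetL]; exact one_ne_zero), hdetL,
    volume_modelTriangle hlam]
  simp

/-- The polygon with vertices `(0,0)`, `(a+b,a+b)`, `(a, a+b/(n-1))`, `(na+b,0)`, described by
linear inequalities. -/
def minimalPolygon (a b : ℝ) (n : ℤ) : Set Pt :=
  {z | 0 ≤ z 1 ∧ z 1 ≤ z 0 ∧ ((n : ℝ) - 1) * z 1 + z 0 ≤ n * a + b ∧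
    ((n : ℝ) - 1) * z 1 ≤ ((n : ℝ) - 2) * z 0 + (a + b)}

theorem vec_mem_minimalPolygon {a b : ℝ} {n : ℤ} {x y : ℝ} :
    (![x, y] : Pt) ∈ minimalPolygon a b n ↔ 0 ≤ y ∧ y ≤ x ∧
      ((n : ℝ) - 1) * y + x ≤ n * a + b ∧ ((n : ℝ) - 1) * y ≤ ((n : ℝ) - 2) * x + (a + b) :=
  Iff.rfl

theorem convex_minimalPolygon (a b : ℝ) (n : ℤ) : Convex ℝ (minimalPolygon a b n) := by
  rintro x ⟨hx1, hx2, hx3, hx4⟩ y ⟨hy1, hy2, hy3, hy4⟩ s t hs ht hst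
  obtain rfl : t = 1 - s := by linarith
  refine ⟨?_, ?_, ?_, ?_⟩ <;> simp only [Pi.add_apply, Pi.smul_apply, smul_eq_mul]
  · nlinarith [mul_le_mul_of_nonneg_left hx1 hs, mul_le_mul_of_nonneg_left hy1 ht]
  · nlinarith [mul_le_mul_of_nonneg_left hx2 hs, mul_le_mul_of_nonneg_left hy2 ht]
  · nlinarith [mul_le_mul_of_nonneg_left hx3 hs, mul_le_mul_of_nonneg_left hy3 ht]
  · nlinarith [mul_le_mul_of_nonneg_left hx4 hs, mul_le_mul_of_nonneg_left hy4 ht]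

theorem combo_mem_convexHull {s : Set Pt} {p q r z : Pt} (hp : p ∈ s) (hq : q ∈ s)
    (hr : r ∈ s) {α β γ : ℝ} (hα : 0 ≤ α) (hβ : 0 ≤ β) (hγ : 0 ≤ γ) (hsum : α + β + γ = 1)
    (h0 : z 0 = α * p 0 + β * q 0 + γ * r 0) (h1 : z 1 = α * p 1 + β * q 1 + γ * r 1) :
    z ∈ convexHull ℝ s := by
  have h := (convex_convexHull ℝ s).sum_mem (t := Finset.univ) (w := ![α, β, γ])
    (z := ![p, q, r]) (by intro i _; fin_cases i <;> simpa)
    (by simpa [Fin.sum_univ_three] using hsum)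
    (by intro i _; fin_cases i <;> exact subset_convexHull ℝ s (by assumption))
  convert h
  ext i
  fin_cases i <;> simpa [Fin.sum_univ_three]

theorem convexHull_eq_minimalPolygon {a b : ℝ} {n : ℤ} (ha : 0 < a) (hab : -a < b)
    (hb : b ≤ 0) (hn : 2 ≤ n) :
    convexHull ℝ
      {![0, 0], ![a + b, a + b], ![a, a + b / ((n : ℝ) - 1)], ![(n : ℝ) * a + b, 0]} =
      minimalPolygon a b n := by
  have hnR : (2 : ℝ) ≤ n := by exact_mod_cast hn
  set r : ℝ := (n : ℝ) - 1 with hr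
  have hr1 : 1 ≤ r := by linarith
  have hr0 : 0 < r := by linarith
  have hnr : (n : ℝ) = r + 1 := by linarith
  have hH : r * (a + b / r) = r * a + b := by field_simp
  set H : ℝ := a + b / r with hHdef
  have hc : 0 < a + b := by linarith
  have hN : 0 < r * a + a + b := by nlinarith
  have hw : 0 < r * a + b := by nlinarith
  apply Subset.antisymm
  · refine convexHull_min ?_ (convex_minimalPolygon a b n)
    intro z hz
    simp only [mem_insert_iff, mem_singleton_iff] at hz
    rcases hz with rfl | rfl | rfl | rfl <;> rw [vec_mem_minimalPolygon, hnr] <;>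
      refine ⟨?_, ?_, ?_, ?_⟩ <;> nlinarith
  · rintro z ⟨h1, h2, h3, h4⟩
    rw [hnr] at h3 h4 ⊢
    by_cases hsum : z 1 / (a + b) + (z 0 - z 1) / ((r + 1) * a + b) ≤ 1
    · refine combo_mem_convexHull (p := ![0, 0]) (q := ![a + b, a + b])
        (r := ![(r + 1) * a + b, 0]) (by simp) (by simp) (by simp)
        (α := 1 - (z 1 / (a + b) + (z 0 - z 1) / ((r + 1) * a + b)))
        (β := z 1 / (a + b)) (γ := (z 0 - z 1) / ((r + 1) * a + b))
        (by linarith) (by positivity)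
        (div_nonneg (by linarith) (by linarith)) (by ring) ?_ ?_
      · have : (r + 1) * a + b ≠ 0 := by nlinarith
        simp only [cons_val_zero, mul_zero, zero_add]
        rw [div_mul_cancel₀ _ hc.ne', div_mul_cancel₀ _ this]
        ring
      · simp
        field_simp
    · push Not at hsum
      have hN' : 0 < (r + 1) * a + b := by nlinarith
      rw [div_add_div _ _ hc.ne' hN'.ne', lt_div_iff₀ (by positivity), one_mul] at hsum
      have hb' : b < 0 := by
        rcases hb.lt_or_eq with h | h
        · exact h
        · subst h
          nlinarith
      have hbr : 0 < -(r * b) := by nlinarith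
      refine combo_mem_convexHull (p := ![a + b, a + b]) (q := ![a, H])
        (r := ![(r + 1) * a + b, 0]) (by simp) (by simp) (by simp)
        (α := ((r + 1) * a + b - z 0 - r * z 1) / (-(r * b)))
        (β := 1 - ((r + 1) * a + b - z 0 - r * z 1) / (-(r * b)) -
          ((r - 1) * z 0 + (a + b) - r * z 1) / (r * (r * a + b)))
        (γ := ((r - 1) * z 0 + (a + b) - r * z 1) / (r * (r * a + b)))
        (div_nonneg (by linarith) hbr.le) ?_ (div_nonneg (by linarith) (by positivity))
        (by ring) ?_ ?_
      · rw [sub_sub, sub_nonneg, div_add_div _ _ hbr.ne' (by positivity),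
          div_le_one (by positivity)]
        linarith [mul_lt_mul_of_pos_left hsum (pow_pos hr0 2)]
      · simp
        have : b ≠ 0 := hb'.ne
        field_simp
        ring
      · simp only [hHdef]
        simp
        have : b ≠ 0 := hb'.ne
        field_simp
        ring

theorem measurableSet_minimalPolygon (a b : ℝ) (n : ℤ) :
    MeasurableSet (minimalPolygon a b n) := by
  have h0 : Continuous fun x : Pt => x 0 := continuous_apply 0
  have h1 : Continuous fun x : Pt => x 1 := continuous_apply 1
  exact (isClosed_le continuous_const h1).measurableSet.inter
    ((isClosed_le h1 h0).measurableSet.inter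
      ((isClosed_le ((h1.const_mul _).add h0) continuous_const).measurableSet.inter
        (isClosed_le (h1.const_mul _)
          ((h0.const_mul _).add continuous_const)).measurableSet))

theorem area_minimalPolygon {a b : ℝ} {n : ℤ} (ha : 0 < a) (hab : -a < b)
    (hb : b ≤ 0) (hn : 2 ≤ n) :
    area (minimalPolygon a b n) = (n * a + 2 * b) * a / 2 := by
  have hnR : (2 : ℝ) ≤ n := by exact_mod_cast hn
  obtain ⟨r, hr⟩ : ∃ r : ℝ, r = (n : ℝ) - 1 := ⟨_, rfl⟩
  have hr1 : 1 ≤ r := by linarith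
  have hr0 : 0 < r := by linarith
  have hnr : (n : ℝ) = r + 1 := by linarith
  have hN : a ≤ (r + 1) * a + b := by nlinarith
  set N : ℝ := (r + 1) * a + b with hNdef
  set m : ℝ → ℝ := fun x => min x (min (((r - 1) * x + (a + b)) / r) ((N - x) / r)) with hm
  have hmc : Continuous m := by fun_prop
  have hslice : ∀ x : ℝ, volume {y : ℝ | (![x, y] : Pt) ∈ minimalPolygon a b n} =
      (Icc 0 N).indicator (fun x => ENNReal.ofReal (m x)) x := by
    intro x
    have h1 : {y : ℝ | (![x, y] : Pt) ∈ minimalPolygon a b n} = Icc 0 (m x) := by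
      ext y
      rw [mem_ofPred_eq, vec_mem_minimalPolygon, mem_Icc, hm, le_min_iff, le_min_iff,
        le_div_iff₀ hr0, le_div_iff₀ hr0, hnr]
      constructor
      · rintro ⟨h1, h2, h3, h4⟩
        exact ⟨h1, h2, by linarith, by linarith⟩
      · rintro ⟨h1, h2, h3, h4⟩
        exact ⟨h1, h2, by linarith, by linarith⟩
    rw [h1, Real.volume_Icc, sub_zero]
    by_cases hx : x ∈ Icc 0 N
    · rw [indicator_of_mem hx]
    · rw [indicator_of_notMem hx, ENNReal.ofReal_eq_zero]
      by_contra! hcon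
      rw [hm, lt_min_iff, lt_min_iff, lt_div_iff₀ hr0, lt_div_iff₀ hr0] at hcon
      exact hx ⟨by linarith, by linarith⟩
  have hint : ∀ u v : ℝ, IntervalIntegrable m volume u v := hmc.intervalIntegrable
  have hN0 : 0 ≤ N := by linarith
  have i1 : ∫ x in (0 : ℝ)..(a + b), m x = (a + b) ^ 2 / 2 := by
    have : EqOn m (fun x => x) (uIcc 0 (a + b)) := by
      intro x hx
      rw [uIcc_of_le (by linarith)] at hx
      refine min_eq_left (le_min ?_ ?_) <;> rw [le_div_iff₀ hr0] <;> nlinarith [hx.1, hx.2]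
    rw [intervalIntegral.integral_congr this, integral_id]
    ring
  have i2 : ∫ x in (a + b)..a, m x =
      (((r - 1) * ((a ^ 2 - (a + b) ^ 2) / 2)) + (a + b) * (-b)) / r := by
    have : EqOn m (fun x => ((r - 1) * x + (a + b)) / r) (uIcc (a + b) a) := by
      intro x hx
      rw [uIcc_of_le (by linarith)] at hx
      have h1 : ((r - 1) * x + (a + b)) / r ≤ (N - x) / r := by
        rw [div_le_div_iff_of_pos_right hr0]
        nlinarith [hx.1, hx.2]
      have h2 : ((r - 1) * x + (a + b)) / r ≤ x := by
        rw [div_le_iff₀ hr0]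
        nlinarith [hx.1, hx.2]
      simp only [hm]
      rw [min_eq_left h1, min_eq_right h2]
    rw [intervalIntegral.integral_congr this, intervalIntegral.integral_div,
      intervalIntegral.integral_add
        (intervalIntegral.intervalIntegrable_id.const_mul _) intervalIntegrable_const,
      intervalIntegral.integral_const_mul, integral_id, intervalIntegral.integral_const,
      smul_eq_mul]
    ring
  have i3 : ∫ x in a..N, m x = (r * a + b) ^ 2 / 2 / r := by
    have : EqOn m (fun x => (N - x) / r) (uIcc a N) := by
      intro x hx
      rw [uIcc_of_le hN] at hx
      have h1 : (N - x) / r ≤ ((r - 1) * x + (a + b)) / r := by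
        rw [div_le_div_iff_of_pos_right hr0]
        nlinarith [hx.1, hx.2]
      have h2 : (N - x) / r ≤ x := by
        rw [div_le_iff₀ hr0]
        nlinarith [hx.1, hx.2]
      simp only [hm]
      rw [min_eq_right h1, min_eq_right h2]
    rw [intervalIntegral.integral_congr this, intervalIntegral.integral_div,
      intervalIntegral.integral_sub intervalIntegrable_const
        intervalIntegral.intervalIntegrable_id, integral_id, intervalIntegral.integral_const,
      smul_eq_mul]
    ring
  have hvol : volume (minimalPolygon a b n) =
      ENNReal.ofReal ((n * a + 2 * b) * a / 2) := by
    rw [volume_eq_lintegral_slice (measurableSet_minimalPolygon a b n)]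
    simp_rw [hslice]
    rw [lintegral_indicator measurableSet_Icc, ← ofReal_integral_eq_lintegral_ofReal,
      integral_Icc_eq_integral_Ioc, ← intervalIntegral.integral_of_le hN0]
    · congr 1
      rw [← intervalIntegral.integral_add_adjacent_intervals (hint 0 (a + b)) (hint _ N),
        ← intervalIntegral.integral_add_adjacent_intervals (hint (a + b) a) (hint _ N),
        i1, i2, i3, hnr]
      field_simp
      ring
    · exact hmc.integrableOn_Icc
    · filter_upwards [ae_restrict_mem measurableSet_Icc] with x hx
      refine le_min hx.1 (le_min (div_nonneg ?_ hr0.le) (div_nonneg ?_ hr0.le))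
      · nlinarith [hx.1]
      · linarith [hx.2]
  rw [area, hvol, ENNReal.toReal_ofReal]
  nlinarith

theorem IsCornerChart.origin {a b : ℝ} {n : ℤ} {u A B C D : ℤ} {lam : ℝ} {S : Set Pt}
    (ha : 0 < a) (hab : -a < b) (hb : b ≤ 0) (hn : 2 ≤ n) (hu : u = 0 ∨ u = 1)
    (H : IsCornerChart (minimalPolygon a b n) a u A B C D ![0, 0] lam S) (hlam : 0 < lam)
    (hS : S ⊆ minimalPolygon a b n) :
    lam ≤ a + b ∧ ∀ s, 0 ≤ s → s < lam → (![s, s] : Pt) ∈ S := by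
  have hnR : (2 : ℝ) ≤ n := by exact_mod_cast hn
  have hray : ∀ s ≤ a, flipRay a u ![0, 0] 1 1 s = ![s, s] := by
    intro s hs
    simp [flipRay, ha.le, hs]
  have hedge := H.right_edge (e0 := 1) (e1 := 1) hlam isCoprime_one_left
    (ε := a + b) (by linarith)
    (fun s hs hs' => by
      rw [hray s (by linarith), vec_mem_minimalPolygon]
      refine ⟨?_, ?_, ?_, ?_⟩ <;> nlinarith)
    (fun z ⟨h1, h2, h3, h4⟩ => by
      have h5 : max (0 - a) 0 = 0 := max_eq_right (by linarith)
      rcases hu with rfl | rfl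
      · simp [flipHeight]
        linarith
      · simp only [flipHeight, cons_val_zero, cons_val_one, h5]
        rcases max_cases (z 0 - a) 0 with ⟨h, h'⟩ | ⟨h, h'⟩ <;> rw [h] <;> push_cast
        · nlinarith
        · linarith)
  have hmem : ∀ s, 0 ≤ s → s < lam → flipRay a u ![0, 0] 1 1 s ∈ S := by
    intro s hs hs'
    rw [H.flipRay_mem_iff, hedge.1, hedge.2]
    simpa using ⟨hs, hs'⟩
  have hle : lam ≤ a + b := by
    by_contra! hcon
    obtain ⟨s, hs1, hs2⟩ := exists_between hcon
    have h1 := hS (hmem s (by linarith) hs2)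
    by_cases hsa : s ≤ a
    · rw [hray s hsa, vec_mem_minimalPolygon] at h1
      linarith [h1.2.2.2]
    · have h5 : max (0 - a) 0 = 0 := max_eq_right (by linarith)
      have h6 : max (s - a) 0 = s - a := max_eq_left (by linarith)
      simp only [flipRay, cons_val_zero, cons_val_one, h5, Int.cast_one, mul_one, zero_add, h6,
        vec_mem_minimalPolygon] at h1
      obtain ⟨h1, h2, h3, h4⟩ := h1
      rcases hu with rfl | rfl
      · push_cast at h4
        linarith
      · push_cast at h3
        nlinarith
  refine ⟨hle, fun s hs hs' => ?_⟩
  rw [← hray s (by linarith)]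
  exact hmem s hs hs'

theorem IsCornerChart.top_left {a b : ℝ} {n : ℤ} {u A B C D : ℤ} {lam : ℝ} {S : Set Pt}
    (hab : -a < b) (hb : b ≤ 0) (hn : 2 ≤ n) (hu : u = 0 ∨ u = 1)
    (H : IsCornerChart (minimalPolygon a b n) a u A B C D ![a + b, a + b] lam S)
    (hlam : 0 < lam) (hS : S ⊆ minimalPolygon a b n) :
    lam ≤ a + b ∧ ∀ s, 0 ≤ s → s < lam → (![a + b - s, a + b - s] : Pt) ∈ S := by
  have hnR : (2 : ℝ) ≤ n := by exact_mod_cast hn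
  have h5 : max (a + b - a) 0 = 0 := max_eq_right (by linarith)
  have hray : ∀ s, 0 ≤ s →
      flipRay a u ![a + b, a + b] (-1) (-1) s = ![a + b - s, a + b - s] := by
    intro s hs
    have h6 : max (a + b - s - a) 0 = 0 := max_eq_right (by linarith)
    simp [flipRay, hb, ← sub_eq_add_neg, h6]
  have hedge := H.left_edge (e0 := -1) (e1 := -1) hlam isCoprime_one_left.neg_left
    (ε := a + b) (by linarith)
    (fun s hs hs' => by
      rw [hray s hs.le, vec_mem_minimalPolygon]
      refine ⟨?_, ?_, ?_, ?_⟩ <;> nlinarith)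
    (fun z ⟨h1, h2, h3, h4⟩ => by
      rcases hu with rfl | rfl
      · simp [flipHeight]
        linarith
      · simp only [flipHeight, cons_val_zero, cons_val_one, h5]
        rcases max_cases (z 0 - a) 0 with ⟨h, h'⟩ | ⟨h, h'⟩ <;> rw [h] <;> push_cast
        · nlinarith
        · linarith)
  have hmem : ∀ s, 0 ≤ s → s < lam → (![a + b - s, a + b - s] : Pt) ∈ S := by
    intro s hs hs'
    rw [← hray s hs, H.flipRay_mem_iff, hedge.1, hedge.2]
    simpa using ⟨hs, hs'⟩
  refine ⟨?_, hmem⟩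
  by_contra! hcon
  obtain ⟨s, hs1, hs2⟩ := exists_between hcon
  have h1 := hS (hmem s (by linarith) hs2)
  rw [vec_mem_minimalPolygon] at h1
  linarith [h1.1]

theorem IsCornerChart.bottom_right {a b h : ℝ} {n : ℤ} {u A B C D : ℤ} {lam : ℝ} {S : Set Pt}
    (ha : 0 < a) (hab : -a < b) (hb : b ≤ 0) (hn : 2 ≤ n) (hu : u = 0 ∨ u = 1)
    (hh : 0 < h) (hh' : h < a + b / ((n : ℝ) - 1))
    (H : IsCornerChart (minimalPolygon a b n) a u A B C D ![n * a + b, 0] lam S)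
    (hlam : 0 < lam) (hS : S ⊆ minimalPolygon a b n) (hc : ![a, h] ∉ S) :
    lam ≤ a ∧ lam ≤ ((n : ℝ) - 1) * a + b - ((n : ℝ) - 2) * h ∧
      (n = 2 → ∀ s, 0 ≤ s → s < lam → s ≤ a + b → (![2 * a + b - s, s] : Pt) ∈ S) := by
  have hnR : (2 : ℝ) ≤ n := by exact_mod_cast hn
  have hr0 : (0 : ℝ) < n - 1 := by linarith
  have hw : 0 < ((n : ℝ) - 1) * a + b := by nlinarith
  have hw' : ((n : ℝ) - 1) * h < ((n : ℝ) - 1) * a + b := by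
    have := mul_lt_mul_of_pos_left hh' hr0
    rwa [mul_add, mul_div_cancel₀ _ hr0.ne'] at this
  have hp : max ((n : ℝ) * a + b - a) 0 = ((n : ℝ) - 1) * a + b := by
    rw [max_eq_left (by linarith)]
    ring
  have hrayL : ∀ s, flipRay a u ![n * a + b, 0] (-(n - 1)) (1 - u * (n - 1)) s =
      ![n * a + b - s * (n - 1), s * (1 - u * (n - 1)) -
        u * (max (n * a + b - s * (n - 1) - a) 0 - ((n - 1) * a + b))] := by
    intro s
    simp only [flipRay, cons_val_zero, cons_val_one, hp]
    push_cast
    ring_nf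
  have hrayL' : ∀ s, s * (n - 1) ≤ (n - 1) * a + b →
      flipRay a u ![n * a + b, 0] (-(n - 1)) (1 - u * (n - 1)) s =
      ![n * a + b - s * (n - 1), s] := by
    intro s hs
    rw [hrayL, max_eq_left (by linarith)]
    congr 2
    ring
  have hrayR : ∀ s ≤ (n - 1) * a + b,
      flipRay a u ![n * a + b, 0] (-1) (-u) s = ![n * a + b - s, 0] := by
    intro s hs
    simp only [flipRay, cons_val_zero, cons_val_one, hp]
    push_cast
    rw [max_eq_left (by linarith)]
    ring_nf
  have hL := H.left_edge (e0 := -(n - 1)) (e1 := 1 - u * (n - 1)) hlam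
    ⟨-u, 1, by ring⟩ (ε := ((n - 1) * a + b) / (n - 1)) (by positivity)
    (fun s hs hs' => by
      rw [lt_div_iff₀ hr0] at hs'
      rw [hrayL' s hs'.le, vec_mem_minimalPolygon]
      refine ⟨?_, ?_, ?_, ?_⟩ <;> nlinarith)
    (fun z ⟨h1, h2, h3, h4⟩ => by
      rcases hu with rfl | rfl
      · simp [flipHeight]
        linarith
      · simp only [flipHeight, cons_val_zero, cons_val_one, hp]
        push_cast
        rcases max_cases (z 0 - a) 0 with ⟨h, h'⟩ | ⟨h, h'⟩ <;> rw [h] <;> nlinarith)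
  have hR := H.right_edge (e0 := -1) (e1 := -u) hlam isCoprime_one_left.neg_left
    (ε := (n - 1) * a + b) hw
    (fun s hs hs' => by
      rw [hrayR s hs'.le, vec_mem_minimalPolygon]
      refine ⟨?_, ?_, ?_, ?_⟩ <;> nlinarith)
    (fun z ⟨h1, h2, h3, h4⟩ => by
      rcases hu with rfl | rfl
      · simp [flipHeight]
        linarith
      · simp only [flipHeight, cons_val_zero, cons_val_one, hp]
        push_cast
        have := le_max_left (z 0 - a) 0
        linarith)
  have hmem : ∀ s, 0 ≤ s → s < lam →
      flipRay a u ![n * a + b, 0] (-(n - 1)) (1 - u * (n - 1)) s ∈ S := by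
    intro s hs hs'
    rw [H.flipRay_mem_iff, hL.1, hL.2]
    simpa using ⟨hs, hs'⟩
  refine ⟨?_, ?_, ?_⟩
  · by_contra! hcon
    obtain ⟨s, hs1, hs2⟩ := exists_between hcon
    have h1 := hS (hmem s (by linarith) hs2)
    rw [hrayL, vec_mem_minimalPolygon] at h1
    obtain ⟨h1, h2, h3, h4⟩ := h1
    rcases hu with rfl | rfl
    · simp only [Int.cast_zero, zero_mul, sub_zero, mul_one] at h4
      nlinarith [mul_pos (mul_pos hr0 hr0) (sub_pos.2 hs1), mul_nonneg hr0.le (neg_nonneg.2 hb)]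
    · rw [max_eq_right (by nlinarith)] at h2
      push_cast at h2
      nlinarith
  · by_contra! hcon
    refine hc ((H.2.1 _).2 ?_)
    have hA : A = -u ∧ B = 1 := by
      constructor
      · linear_combination (-u) * hL.1 - (1 - u * (n - 1)) * hR.1
      · linear_combination hL.1 - (n - 1) * hR.1
    have hC : C = -(1 - u * (n - 1)) ∧ D = -(n - 1) := by
      constructor
      · linear_combination (-u) * hL.2 - (1 - u * (n - 1)) * hR.2
      · linear_combination hL.2 - (n - 1) * hR.2
    simp only [flipHeight, cons_val_zero, cons_val_one, hp, hA.1, hA.2, hC.1, hC.2, sub_self,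
      max_self]
    push_cast
    refine ⟨?_, ?_, ?_⟩ <;> nlinarith
  · rintro rfl s hs hs' hsab
    have h1 := hmem s hs hs'
    rw [hrayL' s (by push_cast; linarith)] at h1
    push_cast at h1
    convert h1 using 3
    ring

theorem IsCornerChart.top_right {a b : ℝ} {n : ℤ} {u A B C D : ℤ} {lam : ℝ} {S : Set Pt}
    (ha : 0 < a) (hab : -a < b) (hb : b < 0) (hn : 2 ≤ n) (hu : u = 0 ∨ u = 1)
    (H : IsCornerChart (minimalPolygon a b n) a u A B C D ![a, a + b / ((n : ℝ) - 1)] lam S)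
    (hlam : 0 < lam) (hS : S ⊆ minimalPolygon a b n) :
    n = 2 ∧ lam ≤ a + b ∧ ∀ s, 0 ≤ s → s < lam → (![a + s, a + b - s] : Pt) ∈ S := by
  have hnR : (2 : ℝ) ≤ n := by exact_mod_cast hn
  have hr0 : (0 : ℝ) < n - 1 := by linarith
  obtain ⟨y, hy⟩ : ∃ y, y = a + b / ((n : ℝ) - 1) := ⟨_, rfl⟩
  have hy' : ((n : ℝ) - 1) * y = (n - 1) * a + b := by
    rw [hy]
    field_simp
  rw [← hy] at H
  have hy0 : 0 < y := by nlinarith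
  have hya : y < a := by nlinarith
  have hrayR : ∀ s, 0 ≤ s → flipRay a u ![a, y] (n - 1) (u * (n - 1) - 1) s =
      ![a + s * (n - 1), y - s] := by
    intro s hs
    simp only [flipRay, cons_val_zero, cons_val_one]
    push_cast
    rw [max_eq_left (by nlinarith), sub_self, max_self]
    congr 2
    ring
  have hrayL : ∀ s, 0 ≤ s → flipRay a u ![a, y] (-(n - 1)) (-(n - 2)) s =
      ![a - s * (n - 1), y - s * (n - 2)] := by
    intro s hs
    simp only [flipRay, cons_val_zero, cons_val_one]
    push_cast
    rw [max_eq_right (by nlinarith), sub_self, max_self]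
    ring_nf
  have hR := H.right_edge (e0 := n - 1) (e1 := u * (n - 1) - 1) hlam
    ⟨u, -1, by ring⟩ (ε := y) hy0
    (fun s hs hs' => by
      rw [hrayR s hs.le, vec_mem_minimalPolygon]
      have := mul_pos hs hr0
      have := mul_nonneg this.le (sub_nonneg.2 hnR)
      refine ⟨?_, ?_, ?_, ?_⟩ <;> nlinarith)
    (fun z ⟨h1, h2, h3, h4⟩ => by
      simp only [flipHeight, cons_val_zero, cons_val_one, sub_self, max_self]
      rcases hu with rfl | rfl
      · push_cast
        nlinarith
      · push_cast
        rcases max_cases (z 0 - a) 0 with ⟨h, h'⟩ | ⟨h, h'⟩ <;> rw [h] <;> nlinarith)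
  have hL := H.left_edge (e0 := -(n - 1)) (e1 := -(n - 2)) hlam
    ⟨-1, 1, by ring⟩ (ε := a - y) (by linarith)
    (fun s hs hs' => by
      rw [hrayL s hs.le, vec_mem_minimalPolygon]
      have := mul_pos hs hr0
      have := mul_nonneg this.le (sub_nonneg.2 hnR)
      refine ⟨?_, ?_, ?_, ?_⟩ <;> nlinarith)
    (fun z ⟨h1, h2, h3, h4⟩ => by
      simp only [flipHeight, cons_val_zero, cons_val_one, sub_self, max_self]
      rcases hu with rfl | rfl
      · push_cast
        nlinarith
      · push_cast
        rcases max_cases (z 0 - a) 0 with ⟨h, h'⟩ | ⟨h, h'⟩ <;> rw [h] <;> nlinarith)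
  have hdet : (n - 1) * ((n - 1) * (1 - u)) = 1 := by
    linear_combination (A * -(n - 1) + B * -(n - 2)) * hR.2 + hL.1 -
      (C * -(n - 1) + D * -(n - 2)) * hR.1 - (n - 1) * ((n - 1) * (1 - u)) * H.1
  have hn2 : n = 2 := by
    rcases Int.isUnit_iff.1 (IsUnit.of_mul_eq_one _ hdet) with h | h <;> omega
  subst hn2
  push_cast at hy'
  have hmem : ∀ s, 0 ≤ s → s < lam → (![a + s, a + b - s] : Pt) ∈ S := by
    intro s hs hs'
    have h1 : flipRay a u ![a, y] (2 - 1) (u * (2 - 1) - 1) s ∈ S := by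
      rw [H.flipRay_mem_iff, hR.1, hR.2]
      simpa using ⟨hs, hs'⟩
    rw [hrayR s hs] at h1
    push_cast at h1
    convert h1 using 3
    · ring
    · linarith
  refine ⟨rfl, ?_, hmem⟩
  by_contra! hcon
  obtain ⟨s, hs1, hs2⟩ := exists_between hcon
  have h1 := hS (hmem s (by linarith) hs2)
  rw [vec_mem_minimalPolygon] at h1
  linarith [h1.1]

theorem sum_sq_le_sq_of_pairwise {ι : Type*} (s : Finset ι) (w : ι → ℝ)
    {c : ℝ} (hc : 0 ≤ c) (hcard : s.card ≤ 2) (hpos : ∀ i ∈ s, 0 ≤ w i)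
    (hle : ∀ i ∈ s, w i ≤ c) (hpair : ∀ i ∈ s, ∀ j ∈ s, i ≠ j → w i + w j ≤ c) :
    ∑ i ∈ s, w i ^ 2 ≤ c ^ 2 := by
  classical
  have h3 : s.card = 0 ∨ s.card = 1 ∨ s.card = 2 := by omega
  rcases h3 with h | h | h
  · rw [Finset.card_eq_zero.1 h, Finset.sum_empty]
    positivity
  · obtain ⟨i, rfl⟩ := Finset.card_eq_one.1 h
    rw [Finset.sum_singleton]
    exact pow_le_pow_left₀ (hpos i (by simp)) (hle i (by simp)) 2
  · obtain ⟨i, j, hij, rfl⟩ := Finset.card_eq_two.1 h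
    rw [Finset.sum_pair hij]
    have h1 := hpos i (by simp)
    have h2 := hpos j (by simp)
    have h3 := hpair i (by simp) j (by simp) hij
    nlinarith [mul_nonneg h1 h2]

theorem card_filter_le_two {ι : Type*} [Fintype ι] {f : ι → Pt}
    (hf : Function.Injective f) {s : Finset ι} {p q : Pt}
    (hs : ∀ i ∈ s, f i = p ∨ f i = q) : s.card ≤ 2 := by
  classical
  calc s.card = (s.image f).card := (Finset.card_image_of_injective s hf).symm
    _ ≤ ({p, q} : Finset Pt).card := by
        refine Finset.card_le_card fun x hx => ?_
        obtain ⟨i, hi, rfl⟩ := Finset.mem_image.1 hx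
        simpa using hs i hi
    _ ≤ 2 := Finset.card_le_two

/-- The area of a semitoric packing of `minimalPolygon` is at most the claimed value. -/
theorem area_packing_le {a b h : ℝ} {n : ℤ} (ha : 0 < a) (hab : -a < b) (hb : b ≤ 0)
    (hn : 2 ≤ n) (hh : 0 < h) (hh' : h < a + b / ((n : ℝ) - 1)) {P : Set Pt}
    (hext : extremePoints ℝ (minimalPolygon a b n) ⊆
      {![0, 0], ![a + b, a + b], ![a, a + b / ((n : ℝ) - 1)], ![(n : ℝ) * a + b, 0]})
    (hP : IsSTPackingIn (minimalPolygon a b n) (![![a, h]] : Fin 1 → Pt)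
      (![1] : Fin 1 → ℤ) P) :
    area P ≤ ((a + b) ^ 2 +
      min (((n : ℝ) - 1) * a + b - ((n : ℝ) - 2) * h) a ^ 2) / 2 := by
  classical
  obtain ⟨N, pt, lam, tri, rfl, hinj, hpt, htri, hdisj⟩ := hP
  have hnR : (2 : ℝ) ≤ n := by exact_mod_cast hn
  have hr0 : (0 : ℝ) < n - 1 := by linarith
  have hw' : ((n : ℝ) - 1) * h < ((n : ℝ) - 1) * a + b := by
    have := mul_lt_mul_of_pos_left hh' hr0
    rwa [mul_add, mul_div_cancel₀ _ hr0.ne'] at this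
  set L := min (((n : ℝ) - 1) * a + b - ((n : ℝ) - 2) * h) a with hL
  have hL0 : 0 < L := lt_min (by linarith) ha
  have hL2 : n = 2 → L = a + b := by
    rintro rfl
    rw [hL, min_eq_left (by push_cast; linarith)]
    push_cast
    ring
  have hpos : ∀ i, 0 < lam i := fun i => (htri i).1
  have hsub : ∀ i, tri i ⊆ minimalPolygon a b n := fun i => (htri i).2.1
  have hmark : ∀ i, ![a, h] ∉ tri i := fun i => (htri i).2.2.1 0
  choose u A B C D hu hchart using fun i => (htri i).exists_chart
  have harea : area (⋃ i, tri i) = ∑ i, lam i ^ 2 / 2 := by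
    rw [area, measure_iUnion hdisj
      (fun i => ((hchart i).measurableSet_and_area (hpos i).le).1), tsum_fintype,
      ENNReal.toReal_sum
        (fun i _ => by rw [((hchart i).measurableSet_and_area (hpos i).le).2]; simp)]
    refine Finset.sum_congr rfl fun i _ => ?_
    rw [((hchart i).measurableSet_and_area (hpos i).le).2,
      ENNReal.toReal_ofReal (by positivity)]
  have hO : ∀ i, pt i = ![0, 0] → lam i ≤ a + b ∧
      ∀ s, 0 ≤ s → s < lam i → (![s, s] : Pt) ∈ tri i := fun i hi =>
    (hi ▸ hchart i).origin ha hab hb hn (hu i) (hpos i) (hsub i)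
  have hQ : ∀ i, pt i = ![a + b, a + b] → lam i ≤ a + b ∧
      ∀ s, 0 ≤ s → s < lam i → (![a + b - s, a + b - s] : Pt) ∈ tri i := fun i hi =>
    (hi ▸ hchart i).top_left hab hb hn (hu i) (hpos i) (hsub i)
  have hR : ∀ i, pt i = ![(n : ℝ) * a + b, 0] → lam i ≤ L ∧
      (n = 2 → ∀ s, 0 ≤ s → s < lam i → s ≤ a + b →
        (![2 * a + b - s, s] : Pt) ∈ tri i) := fun i hi =>
    have h1 := (hi ▸ hchart i).bottom_right ha hab hb hn (hu i) hh hh' (hpos i) (hsub i)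
      (hmark i)
    ⟨le_min h1.2.1 h1.1, h1.2.2⟩
  have hF : ∀ i, pt i = ![a, a + b / ((n : ℝ) - 1)] → b < 0 →
      n = 2 ∧ lam i ≤ a + b ∧
        ∀ s, 0 ≤ s → s < lam i → (![a + s, a + b - s] : Pt) ∈ tri i := fun i hi hb' =>
    (hi ▸ hchart i).top_right ha hab hb' hn (hu i) (hpos i) (hsub i)
  have hdisj' : ∀ i j x, i ≠ j → x ∈ tri i → x ∈ tri j → False := fun i j x hij hi hj =>
    Set.disjoint_left.1 (hdisj hij) hi hj
  have hcross : ∀ {x y c : ℝ}, 0 < x → 0 < y → x ≤ c → y ≤ c → c < x + y →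
      ∃ s, 0 ≤ s ∧ s < x ∧ 0 ≤ c - s ∧ c - s < y := by
    intro x y c hx hy hxc hyc hxy
    obtain ⟨s, hs, hs'⟩ := exists_between (show c - y < x by linarith)
    exact ⟨s, by linarith, hs', by linarith, by linarith⟩
  have hOQ : ∀ i j, pt i = ![0, 0] → pt j = ![a + b, a + b] → i ≠ j →
      lam i + lam j ≤ a + b := by
    intro i j hi hj hij
    by_contra! hcon
    obtain ⟨s, hs1, hs2, hs3, hs4⟩ := hcross (hpos i) (hpos j) (hO i hi).1 (hQ j hj).1 hcon
    refine hdisj' i j _ hij ((hO i hi).2 s hs1 hs2) ?_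
    simpa using (hQ j hj).2 _ hs3 hs4
  have hFR : ∀ i j, pt i = ![a, a + b / ((n : ℝ) - 1)] → b < 0 →
      pt j = ![(n : ℝ) * a + b, 0] → i ≠ j → lam i + lam j ≤ L := by
    intro i j hi hb' hj hij
    have hFi := hF i hi hb'
    have hRj := hR j hj
    rw [hL2 hFi.1] at hRj ⊢
    by_contra! hcon
    obtain ⟨s, hs1, hs2, hs3, hs4⟩ := hcross (hpos i) (hpos j) hFi.2.1 hRj.1 hcon
    refine hdisj' i j _ hij (hFi.2.2 s hs1 hs2) ?_
    convert hRj.2 hFi.1 _ hs3 hs4 (by linarith) using 3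
    ring
  set s₁ := Finset.univ.filter fun i => pt i = ![0, 0] ∨ pt i = ![a + b, a + b] with hs₁
  set s₂ := Finset.univ.filter fun i => ¬(pt i = ![0, 0] ∨ pt i = ![a + b, a + b]) with hs₂
  have hm₁ : ∀ i ∈ s₁, pt i = ![0, 0] ∨ pt i = ![a + b, a + b] := fun i hi =>
    (Finset.mem_filter.1 hi).2
  have hm₂ : ∀ i ∈ s₂, (pt i = ![a, a + b / ((n : ℝ) - 1)] ∧ b < 0) ∨
      pt i = ![(n : ℝ) * a + b, 0] := by
    intro i hi
    have h1 := (Finset.mem_filter.1 hi).2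
    rcases hext (hpt i) with h2 | h2 | h2 | h2
    · exact absurd (Or.inl h2) h1
    · exact absurd (Or.inr h2) h1
    · refine Or.inl ⟨h2, lt_of_le_of_ne hb ?_⟩
      rintro rfl
      exact h1 (Or.inr (by simpa using h2))
    · exact Or.inr h2
  have hsum₁ : ∑ i ∈ s₁, lam i ^ 2 ≤ (a + b) ^ 2 := by
    refine sum_sq_le_sq_of_pairwise s₁ lam (by linarith) (card_filter_le_two hinj hm₁)
      (fun i _ => (hpos i).le) (fun i hi => ?_) (fun i hi j hj hij => ?_)
    · rcases hm₁ i hi with h1 | h1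
      · exact (hO i h1).1
      · exact (hQ i h1).1
    · rcases hm₁ i hi with h1 | h1 <;> rcases hm₁ j hj with h2 | h2
      · exact absurd (hinj (h1.trans h2.symm)) hij
      · exact hOQ i j h1 h2 hij
      · rw [add_comm]
        exact hOQ j i h2 h1 hij.symm
      · exact absurd (hinj (h1.trans h2.symm)) hij
  have hsum₂ : ∑ i ∈ s₂, lam i ^ 2 ≤ L ^ 2 := by
    refine sum_sq_le_sq_of_pairwise s₂ lam hL0.le
      (card_filter_le_two hinj fun i hi => (hm₂ i hi).imp_left And.left)
      (fun i _ => (hpos i).le) (fun i hi => ?_) (fun i hi j hj hij => ?_)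
    · rcases hm₂ i hi with h1 | h1
      · have h2 := hF i h1.1 h1.2
        rw [hL2 h2.1]
        exact h2.2.1
      · exact (hR i h1).1
    · rcases hm₂ i hi with h1 | h1 <;> rcases hm₂ j hj with h2 | h2
      · exact absurd (hinj (h1.1.trans h2.1.symm)) hij
      · exact hFR i j h1.1 h1.2 h2 hij
      · rw [add_comm]
        exact hFR j i h2.1 h2.2 h1 hij.symm
      · exact absurd (hinj (h1.trans h2.symm)) hij
  rw [harea, ← Finset.sum_div, ← Finset.sum_filter_add_sum_filter_not Finset.univ
    (fun i => pt i = ![0, 0] ∨ pt i = ![a + b, a + b])]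
  linarith

theorem isCornerChart_origin {a b : ℝ} {n : ℤ} (hab : -a < b) (hb : b ≤ 0) (hn : 2 ≤ n) :
    IsCornerChart (minimalPolygon a b n) a 0 1 (-1) 0 1 ![0, 0] (a + b)
      {z | 0 ≤ z 1 ∧ z 1 ≤ z 0 ∧ z 0 < a + b} := by
  have hnR : (2 : ℝ) ≤ n := by exact_mod_cast hn
  refine ⟨by norm_num, fun z => ?_, {z | z 0 < a + b},
    isOpen_lt (continuous_apply 0) continuous_const, ?_, fun z hz => ?_⟩
  · simp only [flipHeight, mem_ofPred_eq, cons_val_zero, cons_val_one]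
    push_cast
    constructor
    · rintro ⟨h1, h2, h3⟩
      refine ⟨?_, ?_, ?_⟩ <;> linarith
    · rintro ⟨h1, h2, h3⟩
      refine ⟨?_, ?_, ?_⟩ <;> linarith
  · change (0 : ℝ) < a + b
    linarith
  · have hz' : z 0 < a + b := hz
    constructor
    · rintro ⟨h1, h2, h3⟩
      exact ⟨h1, h2, by nlinarith, by nlinarith⟩
    · rintro ⟨h1, h2, -, -⟩
      exact ⟨h1, h2, hz'⟩

/-- The triangle of size `lam` at the vertex `(na+b, 0)` in the representative with flipped
cut. -/
def flippedCornerTriangle (a b : ℝ) (n : ℤ) (lam : ℝ) : Set Pt :=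
  {z | 0 ≤ n * a + b - z 0 + (z 1 + max (z 0 - a) 0 - (((n : ℝ) - 1) * a + b)) ∧
    0 ≤ ((n : ℝ) - 2) * (z 0 - (n * a + b)) -
      ((n : ℝ) - 1) * (z 1 + max (z 0 - a) 0 - (((n : ℝ) - 1) * a + b)) ∧
    n * a + b - z 0 + ((n : ℝ) - 2) * (z 0 - (n * a + b)) -
      ((n : ℝ) - 2) * (z 1 + max (z 0 - a) 0 - (((n : ℝ) - 1) * a + b)) < lam}

theorem isCornerChart_flippedCornerTriangle {a b lam : ℝ} {n : ℤ} (ha : 0 < a) (hab : -a < b)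
    (hb : b ≤ 0) (hn : 2 ≤ n) (hlam : 0 < lam) :
    IsCornerChart (minimalPolygon a b n) a 1 (-1) 1 (n - 2) (-(n - 1)) ![(n : ℝ) * a + b, 0]
      lam (flippedCornerTriangle a b n lam) := by
  have hnR : (2 : ℝ) ≤ n := by exact_mod_cast hn
  have hw : 0 < ((n : ℝ) - 1) * a + b := by nlinarith
  have hp : max ((n : ℝ) * a + b - a) 0 = ((n : ℝ) - 1) * a + b := by
    rw [max_eq_left (by linarith)]
    ring
  refine ⟨by ring, fun z => ?_, {z | a < z 0 ∧ n * a + b - z 0 - ((n : ℝ) - 2) * z 1 < lam},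
    ?_, ?_, fun z hz => ?_⟩
  · simp only [flipHeight, flippedCornerTriangle, mem_ofPred_eq, cons_val_zero, cons_val_one, hp]
    push_cast
    constructor <;>
    · rintro ⟨h1, h2, h3⟩
      refine ⟨?_, ?_, ?_⟩ <;> linarith
  · have h1 : Continuous fun z : Pt => n * a + b - z 0 - ((n : ℝ) - 2) * z 1 := by fun_prop
    exact (isOpen_lt continuous_const (continuous_apply 0)).inter
      (isOpen_lt h1 continuous_const)
  · simp only [mem_ofPred_eq, cons_val_zero, cons_val_one]
    exact ⟨by linarith, by linarith⟩
  · obtain ⟨hz1, hz2⟩ := hz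
    simp only [flippedCornerTriangle, mem_ofPred_eq, max_eq_left (sub_nonneg.2 hz1.le)]
    constructor
    · rintro ⟨h1, h2, -⟩
      have h5 : 0 ≤ z 1 := by linarith
      have h6 : ((n : ℝ) - 1) * z 1 + z 0 ≤ n * a + b := by linarith
      exact ⟨h5, by nlinarith, h6, by nlinarith⟩
    · rintro ⟨h1, h2, h3, h4⟩
      refine ⟨?_, ?_, ?_⟩ <;> linarith

theorem lt_of_mem_flippedCornerTriangle {a b lam : ℝ} {n : ℤ} (hn : 2 ≤ n) (hla : lam ≤ a)
    {z : Pt} (hz : z ∈ flippedCornerTriangle a b n lam) : a + b < z 0 := by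
  have hnR : (2 : ℝ) ≤ n := by exact_mod_cast hn
  obtain ⟨h1, h2, h3⟩ := hz
  nlinarith

theorem flippedCornerTriangle_subset {a b lam : ℝ} {n : ℤ} (hab : -a < b)
    (hn : 2 ≤ n) (hla : lam ≤ a) (hl2 : n = 2 → lam ≤ a + b) :
    flippedCornerTriangle a b n lam ⊆ minimalPolygon a b n := by
  intro z hz
  have hx := lt_of_mem_flippedCornerTriangle hn hla hz
  have hnR : (2 : ℝ) ≤ n := by exact_mod_cast hn
  obtain ⟨h1, h2, h3⟩ := hz
  rcases max_cases (z 0 - a) 0 with ⟨h, h'⟩ | ⟨h, h'⟩ <;> rw [h] at h1 h2 h3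
  · have h5 : 0 ≤ z 1 := by linarith
    have h6 : ((n : ℝ) - 1) * z 1 + z 0 ≤ n * a + b := by linarith
    exact ⟨h5, by nlinarith, h6, by nlinarith⟩
  · have h6 : ((n : ℝ) - 1) * z 1 ≤ ((n : ℝ) - 2) * z 0 + (a + b) := by linarith
    refine ⟨?_, by nlinarith, by nlinarith, h6⟩
    obtain rfl | hn3 : n = 2 ∨ 3 ≤ n := by omega
    · have := hl2 rfl
      push_cast at h3
      linarith
    · have hnR3 : (3 : ℝ) ≤ n := by exact_mod_cast hn3
      nlinarith

theorem origin_mem_extremePoints {a b : ℝ} {n : ℤ} (ha : 0 < a) (hab : -a < b)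
    (hn : 2 ≤ n) : (![0, 0] : Pt) ∈ extremePoints ℝ (minimalPolygon a b n) := by
  have hnR : (2 : ℝ) ≤ n := by exact_mod_cast hn
  refine ⟨?_, ?_⟩
  · rw [vec_mem_minimalPolygon]
    exact ⟨le_rfl, le_rfl, by nlinarith, by linarith⟩
  · rintro x ⟨hx1, hx2, -, -⟩ y ⟨hy1, hy2, -, -⟩ ⟨s, t, hs, ht, hst, hxy⟩
    have h0 := congrFun hxy 0
    have h1 := congrFun hxy 1
    simp only [Pi.add_apply, Pi.smul_apply, smul_eq_mul, cons_val_zero, cons_val_one] at h0 h1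
    have e0 : x 0 = 0 := by nlinarith
    ext i
    fin_cases i
    · exact e0
    · exact le_antisymm (by simpa [e0] using hx2) hx1

theorem bottom_right_mem_extremePoints {a b : ℝ} {n : ℤ} (ha : 0 < a) (hab : -a < b)
    (hn : 2 ≤ n) :
    (![(n : ℝ) * a + b, 0] : Pt) ∈ extremePoints ℝ (minimalPolygon a b n) := by
  have hnR : (2 : ℝ) ≤ n := by exact_mod_cast hn
  refine ⟨?_, ?_⟩
  · rw [vec_mem_minimalPolygon]
    have h1 : 0 ≤ (n : ℝ) * a + b := by nlinarith
    have h2 := mul_nonneg (sub_nonneg.2 hnR) h1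
    exact ⟨le_rfl, h1, by linarith, by linarith⟩
  · rintro x ⟨hx1, -, hx3, -⟩ y ⟨hy1, -, hy3, -⟩ ⟨s, t, hs, ht, hst, hxy⟩
    have h0 := congrFun hxy 0
    have h1 := congrFun hxy 1
    simp only [Pi.add_apply, Pi.smul_apply, smul_eq_mul, cons_val_zero, cons_val_one] at h0 h1
    have e1 : x 1 = 0 := by nlinarith
    have hx0 : x 0 ≤ n * a + b := by nlinarith
    have hy0 : y 0 ≤ n * a + b := by nlinarith
    have e0 : x 0 = n * a + b := by
      obtain rfl : t = 1 - s := by linarith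
      nlinarith
    ext i
    fin_cases i
    · exact e0
    · exact e1

theorem isLUB_stDensitySet_minimalPolygon {a b h : ℝ} {n : ℤ} (ha : 0 < a) (hab : -a < b)
    (hb : b ≤ 0) (hn : 2 ≤ n) (hh : 0 < h) (hh' : h < a + b / ((n : ℝ) - 1)) :
    IsLUB (stDensitySet (minimalPolygon a b n) (![![a, h]] : Fin 1 → Pt) (![1] : Fin 1 → ℤ))
      (((a + b) ^ 2 + min ((((n : ℝ) - 1) * a + b - ((n : ℝ) - 2) * h) ^ 2) (a ^ 2)) /
        (((n : ℝ) * a + 2 * b) * a)) := by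
  have hnR : (2 : ℝ) ≤ n := by exact_mod_cast hn
  have hr0 : (0 : ℝ) < n - 1 := by linarith
  have hw' : ((n : ℝ) - 1) * h < ((n : ℝ) - 1) * a + b := by
    have := mul_lt_mul_of_pos_left hh' hr0
    rwa [mul_add, mul_div_cancel₀ _ hr0.ne'] at this
  have hX : 0 < ((n : ℝ) - 1) * a + b - ((n : ℝ) - 2) * h := by linarith
  have hsq : min ((((n : ℝ) - 1) * a + b - ((n : ℝ) - 2) * h) ^ 2) (a ^ 2) =
      min (((n : ℝ) - 1) * a + b - ((n : ℝ) - 2) * h) a ^ 2 := by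
    rcases le_total (((n : ℝ) - 1) * a + b - ((n : ℝ) - 2) * h) a with h1 | h1
    · rw [min_eq_left h1, min_eq_left (pow_le_pow_left₀ hX.le h1 2)]
    · rw [min_eq_right h1, min_eq_right (pow_le_pow_left₀ ha.le h1 2)]
  have hden : 0 < ((n : ℝ) * a + 2 * b) * a := mul_pos (by nlinarith) ha
  rw [hsq]
  set L := min (((n : ℝ) - 1) * a + b - ((n : ℝ) - 2) * h) a with hL
  have hL0 : 0 < L := lt_min hX ha
  have hLX : L ≤ ((n : ℝ) - 1) * a + b - ((n : ℝ) - 2) * h := min_le_left _ _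
  have hLa : L ≤ a := min_le_right _ _
  have hext : extremePoints ℝ (minimalPolygon a b n) ⊆
      {![0, 0], ![a + b, a + b], ![a, a + b / ((n : ℝ) - 1)], ![(n : ℝ) * a + b, 0]} := by
    rw [← convexHull_eq_minimalPolygon ha hab hb hn]
    exact extremePoints_convexHull_subset
  have hval : ∀ x : ℝ, x / (((n : ℝ) * a + 2 * b) * a) =
      x / 2 / area (minimalPolygon a b n) := by
    intro x
    rw [area_minimalPolygon ha hab hb hn, div_div_div_cancel_right₀ two_ne_zero]
  rw [hval]
  refine IsGreatest.isLUB ⟨?_, ?_⟩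
  · set S₁ : Set Pt := {z | 0 ≤ z 1 ∧ z 1 ≤ z 0 ∧ z 0 < a + b} with hS₁
    set S₂ := flippedCornerTriangle a b n L with hS₂
    have H₁ : IsCornerChart (minimalPolygon a b n) a 0 1 (-1) 0 1 ![0, 0] (a + b) S₁ :=
      isCornerChart_origin hab hb hn
    have H₂ := isCornerChart_flippedCornerTriangle ha hab hb hn hL0
    rw [← hS₂] at H₂
    have hdisj : Disjoint S₁ S₂ := by
      rw [Set.disjoint_left]
      intro z hz1 hz2
      exact lt_asymm hz1.2.2 (lt_of_mem_flippedCornerTriangle hn hLa hz2)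
    have hT₁ := H₁.isSTPackedTriangleIn (h := h) (Or.inl rfl) (by linarith)
      (fun z ⟨h1, h2, h3⟩ => ⟨h1, h2, by nlinarith, by nlinarith⟩)
      (fun hz => by
        have h3 : a < a + b := hz.2.2
        linarith)
    have hT₂ := H₂.isSTPackedTriangleIn (h := h) (Or.inr rfl) hL0
      (flippedCornerTriangle_subset hab hn hLa
        (by rintro rfl; push_cast at hLX; linarith))
      (fun hz => by
        have h3 := hz.2.2
        simp only [cons_val_zero, cons_val_one, sub_self, max_self] at h3
        linarith)
    refine ⟨S₁ ∪ S₂, ⟨2, ![![0, 0], ![n * a + b, 0]], ![a + b, L], ![S₁, S₂], ?_, ?_, ?_, ?_, ?_⟩,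
      ?_⟩
    · ext z
      simp [Fin.exists_fin_two]
    · have hne : (![0, 0] : Pt) ≠ ![n * a + b, 0] := by
        intro heq
        have h0 := congrFun heq 0
        simp only [cons_val_zero] at h0
        nlinarith
      intro i j hij
      fin_cases i <;> fin_cases j <;> first | rfl | exact absurd hij hne | exact absurd hij hne.symm
    · intro i
      fin_cases i
      · exact origin_mem_extremePoints ha hab hn
      · exact bottom_right_mem_extremePoints ha hab hn
    · intro i
      fin_cases i
      · exact hT₁
      · exact hT₂
    · intro i j hij
      fin_cases i <;> fin_cases j
      · exact absurd rfl hij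
      · exact hdisj
      · exact hdisj.symm
      · exact absurd rfl hij
    · have hA₁ := H₁.measurableSet_and_area (by linarith)
      have hA₂ := H₂.measurableSet_and_area hL0.le
      have harea : area (S₁ ∪ S₂) = ((a + b) ^ 2 + L ^ 2) / 2 := by
        rw [area, measure_union hdisj hA₂.1, hA₁.2, hA₂.2,
          ← ENNReal.ofReal_add (by positivity) (by positivity),
          ENNReal.toReal_ofReal (by positivity)]
        ring
      rw [harea]
  · rintro _ ⟨P, hP, rfl⟩
    refine div_le_div_of_nonneg_right (area_packing_le ha hab hb hn hh hh' hext hP) ?_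
    exact ENNReal.toReal_nonneg

/-- (i) The minimal semitoric polygon of type (3b) — vertices `(0,0)`,
`(a,a)`, `(na,0)`, marked point `(a,h)` with `0 < h < a`, upward cut, `n ≥ 2` — has
semitoric packing density `ρ_ST = 2/n`, independent of `h`.
(ii) The minimal semitoric polygon of type (3c) — vertices `(0,0)`, `(a+b,a+b)`,
`(a, a+b/(n−1))`, `(na+b,0)`, with `−a < b < 0`, `n ≥ 2`, marked point `(a,h)` with
`0 < h < a + b/(n−1)`, upward cut — has
`ρ_ST = ((a+b)² + min(((n−1)a+b−(n−2)h)², a²)) / ((na+2b)a)`. -/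
theorem stmt17 :
    (∀ (a h : ℝ) (n : ℤ), 0 < a → 2 ≤ n → 0 < h → h < a →
      IsLUB
        (stDensitySet
          (convexHull ℝ {![0, 0], ![a, a], ![(n : ℝ) * a, 0]})
          (![![a, h]] : Fin 1 → Pt) (![1] : Fin 1 → ℤ))
        (2 / (n : ℝ))) ∧
    (∀ (a b h : ℝ) (n : ℤ), 0 < a → -a < b → b < 0 → 2 ≤ n →
      0 < h → h < a + b / ((n : ℝ) - 1) →
      IsLUB
        (stDensitySet
          (convexHull ℝ
            {![0, 0], ![a + b, a + b], ![a, a + b / ((n : ℝ) - 1)], ![(n : ℝ) * a + b, 0]})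
          (![![a, h]] : Fin 1 → Pt) (![1] : Fin 1 → ℤ))
        (((a + b) ^ 2 + min ((((n : ℝ) - 1) * a + b - ((n : ℝ) - 2) * h) ^ 2) (a ^ 2)) /
          (((n : ℝ) * a + 2 * b) * a))) := by
  refine ⟨fun a h n ha hn hh hh' => ?_, fun a b h n ha hab hb hn hh hh' => ?_⟩
  · have hnR : (2 : ℝ) ≤ n := by exact_mod_cast hn
    have hset : ({![0, 0], ![a, a], ![(n : ℝ) * a, 0]} : Set Pt) =
        {![0, 0], ![a + 0, a + 0], ![a, a + 0 / ((n : ℝ) - 1)], ![(n : ℝ) * a + 0, 0]} := by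
      simp
    have hX : a ≤ ((n : ℝ) - 1) * a + 0 - ((n : ℝ) - 2) * h := by nlinarith
    have key := isLUB_stDensitySet_minimalPolygon (b := 0) ha (by linarith) le_rfl hn hh
      (by simpa using hh')
    rw [hset, convexHull_eq_minimalPolygon ha (by linarith) le_rfl hn]
    convert key using 1
    rw [min_eq_right (pow_le_pow_left₀ ha.le hX 2)]
    field_simp
    ring
  · rw [convexHull_eq_minimalPolygon ha hab hb.le hn]
    exact isLUB_stDensitySet_minimalPolygon ha hab hb.le hn hh hh'
end

section
/- Let (Δ, c⃗, ε⃗) be a semitoric polygon representative and let B ⊂ Δ be an admissibly packed triangle at some vertex such that e := closure(B) \ B is a vertical line segment. Then B does not intersect any cut of Δ (so B is an actual triangle of the form M(B(λ)) + p with M ∈ SL₂(ℤ)), and the two edges of B other than e have integer slopes which differ by exactly one. -/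
open Matrix MeasureTheory Set

/-- The determinant of a pair of integer vectors in the plane. -/
def detZ (u v : Fin 2 → ℤ) : ℤ := u 0 * v 1 - u 1 * v 0

/-- The matrix `Tⁿ`, where `T = [[1,0],[1,1]]`. -/
def Tpow (n : ℤ) : Matrix (Fin 2) (Fin 2) ℤ := !![1, 0; n, 1]

/-- The combinatorial data of a semitoric polygon representative: a convex polygon with
vertices `V i` listed in clockwise order, the edge from `V i` to `V (i+1)` directed along
the primitive integer vector `dir i` with `SL₂(ℤ)`-length `len i`, together with marked
points `c j` and cut directions `eps j ∈ {±1}`. -/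
structure STRep (d m : ℕ) where
  V : Fin d → Pt
  dir : Fin d → Fin 2 → ℤ
  len : Fin d → ℝ
  c : Fin m → Pt
  eps : Fin m → ℤ

namespace STRep

variable {d m : ℕ}

/-- The underlying polygon (as a subset of the plane). -/
noncomputable def carrier (R : STRep d m) : Set Pt := convexHull ℝ (Set.range R.V)

/-- The cut of the marked point `c j` (the vertical ray from `c j` in the direction
`eps j`) meets the boundary of the polygon at the point `z`. -/
def CutHits (R : STRep d m) (j : Fin m) (z : Pt) : Prop :=
  z ∈ frontier R.carrier ∧ z 0 = R.c j 0 ∧ 0 ≤ (R.eps j : ℝ) * (z 1 - R.c j 1)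

/-- The number of cuts meeting the boundary of the polygon at the vertex `V i`. -/
noncomputable def numCuts (R : STRep d m) (i : Fin d) : ℕ :=
  Set.ncard {j | R.CutHits j (R.V i)}

/-- The first primitive integer vector emanating from the vertex `V i`
(so that `det (u1, u2) > 0` for a clockwise polygon). -/
def u1 [NeZero d] (R : STRep d m) (i : Fin d) : Fin 2 → ℤ := fun k => - R.dir (i - 1) k

/-- The second primitive integer vector emanating from the vertex `V i`. -/
def u2 (R : STRep d m) (i : Fin d) : Fin 2 → ℤ := R.dir i

/-- The vertex `V i` is a fake corner: at least one cut meets it and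
`det (u₁, Tᵏ u₂) = 0` where `k` is the number of cuts meeting it. -/
def IsFakeCorner [NeZero d] (R : STRep d m) (i : Fin d) : Prop :=
  0 < R.numCuts i ∧ detZ (R.u1 i) ((Tpow (R.numCuts i : ℤ)).mulVec (R.u2 i)) = 0

/-- The vertex `V i` is a hidden or Delzant corner (i.e. not a fake corner). -/
def IsHDCorner [NeZero d] (R : STRep d m) (i : Fin d) : Prop := ¬ R.IsFakeCorner i

/-- `R` is a valid semitoric polygon representative: the polygon is convex and rational
with vertices in clockwise order, the marked points lie in the interior, the cut
directions are `±1`, every point where exactly `k ≥ 1` cuts meet the boundary is a vertex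
satisfying the fake (`det (u₁, Tᵏ u₂) = 0`) or hidden (`det (u₁, Tᵏ u₂) = 1`) corner
condition, and every other vertex satisfies the Delzant condition
`det (u₁, u₂) = ±1`. -/
structure IsValid [NeZero d] (R : STRep d m) : Prop where
  three_le : 3 ≤ d
  len_pos : ∀ i, 0 < R.len i
  primitive : ∀ i, Int.gcd (R.dir i 0) (R.dir i 1) = 1
  edge_eq : ∀ i k, R.V (i + 1) k - R.V i k = R.len i * (R.dir i k : ℝ)
  clockwise : ∀ i, detZ (R.dir i) (R.dir (i + 1)) < 0
  edges_boundary : ∀ i, segment ℝ (R.V i) (R.V (i + 1)) ⊆ frontier R.carrier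
  marked_interior : ∀ j, R.c j ∈ interior R.carrier
  eps_pm : ∀ j, R.eps j = 1 ∨ R.eps j = -1
  cuts_at_vertices : ∀ j z, R.CutHits j z → ∃ i, z = R.V i
  corner_delzant : ∀ i, R.numCuts i = 0 →
    detZ (R.u1 i) (R.u2 i) = 1 ∨ detZ (R.u1 i) (R.u2 i) = -1
  corner_cut : ∀ i, 0 < R.numCuts i →
    detZ (R.u1 i) ((Tpow (R.numCuts i : ℤ)).mulVec (R.u2 i)) = 0 ∨
    detZ (R.u1 i) ((Tpow (R.numCuts i : ℤ)).mulVec (R.u2 i)) = 1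

end STRep

/-- An admissibly packed triangle in the semitoric polygon representative `R`. -/
def IsSTPackedTriangle {d m : ℕ} (R : STRep d m) (p : Pt) (lam : ℝ) (B : Set Pt) :
    Prop :=
  IsSTPackedTriangleIn R.carrier R.c R.eps p lam B

/-- `g` enumerates the hidden and Delzant corners of `R` in (clockwise) cyclic order:
`g` is strictly monotone and its range is exactly the set of hidden/Delzant corners. -/
def IsCornerEnum {d m D : ℕ} [NeZero d] (R : STRep d m) (g : Fin D → Fin d) : Prop :=
  StrictMono g ∧ ∀ i, R.IsHDCorner i ↔ ∃ a, g a = i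

/-- `P` is a semitoric packing of `R` whose triangle at the hidden/Delzant corner
`V (g a)` has `SL₂(ℤ)`-size `sz a` (with `sz a = 0` if no triangle is packed there). -/
def IsSTPacking {d m D : ℕ} (R : STRep d m) (g : Fin D → Fin d)
    (sz : Fin D → ℝ) (P : Set Pt) : Prop :=
  ∃ tri : Fin D → Set Pt,
    P = (⋃ a, tri a) ∧
    (∀ a, (sz a = 0 ∧ tri a = ∅) ∨
       IsSTPackedTriangle R (R.V (g a)) (sz a) (tri a)) ∧
    Pairwise (Function.onFun Disjoint tri)

/-- The number of steps from `s` to `i` going cyclically forwards in `Fin d`. -/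
def distCyc {d : ℕ} (s i : Fin d) : ℕ := (i.val + d - s.val) % d

/-- The number of edges in the cyclic chain of edges from vertex `s` to vertex `e`
(the whole cycle when `e = s`). -/
def chainLen {d : ℕ} (s e : Fin d) : ℕ := if e = s then d else distCyc s e

/-- The `SL₂(ℤ)`-length `ℓ_a` of the `a`-th semitoric edge: the sum of the
`SL₂(ℤ)`-lengths of the edges in the chain (joined at fake corners) connecting the
hidden/Delzant corner `V (g a)` to the next one `V (g (a+1))`. -/
noncomputable def stEdgeLen {d m D : ℕ} [NeZero D] (R : STRep d m) (g : Fin D → Fin d)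
    (a : Fin D) : ℝ :=
  ∑ i : Fin d, if distCyc (g a) i < chainLen (g a) (g (a + 1)) then R.len i else 0

/-- The point `q` lies on one of the two semitoric edges emanating from the
hidden/Delzant corner `V (g a)`, and `t` is the `SL₂(ℤ)`-length of the boundary path
(contained in that single semitoric edge) from `V (g a)` to `q`. -/
def OnEmanating {d m D : ℕ} [NeZero D] (R : STRep d m) (g : Fin D → Fin d)
    (a : Fin D) (q : Pt) (t : ℝ) : Prop :=
  (∃ (i : Fin d) (s : ℝ), distCyc (g a) i < chainLen (g a) (g (a + 1)) ∧
      0 ≤ s ∧ s ≤ R.len i ∧ (∀ k, q k = R.V i k + s * (R.dir i k : ℝ)) ∧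
      t = (∑ i' : Fin d, if distCyc (g a) i' < distCyc (g a) i then R.len i' else 0) + s) ∨
  (∃ (i : Fin d) (s : ℝ), distCyc (g (a - 1)) i < chainLen (g (a - 1)) (g a) ∧
      0 ≤ s ∧ s ≤ R.len i ∧ (∀ k, q k = R.V i k + s * (R.dir i k : ℝ)) ∧
      t = (∑ i' : Fin d, if distCyc (g (a - 1)) i < distCyc (g (a - 1)) i' ∧
              distCyc (g (a - 1)) i' < chainLen (g (a - 1)) (g a) then R.len i' else 0)
          + (R.len i - s))

/-- `lam ≤ α_a`, where `α_a` is the marked-point bound at the hidden/Delzant corner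
`V (g a)`: for each marked point `c j` whose vertical line meets a semitoric edge
emanating from `V (g a)`, taking the intersection point `q` whose boundary path from the
corner has minimal `SL₂(ℤ)`-length `t`, one has `lam ≤ t + b · |v₁ − w₁|`, where `b` is
the vertical distance from `c j` to `q` and `v, w` are the primitive integer vectors
directing the edges emanating from the corner. (`α_a = ∞` when there is no such marked
point, in which case this is no condition.) -/
def AlphaBound {d m D : ℕ} [NeZero d] [NeZero D] (R : STRep d m) (g : Fin D → Fin d)
    (a : Fin D) (lam : ℝ) : Prop :=
  ∀ (j : Fin m) (q : Pt) (t : ℝ),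
    OnEmanating R g a q t → q 0 = R.c j 0 →
    (∀ (q' : Pt) (t' : ℝ), OnEmanating R g a q' t' → q' 0 = R.c j 0 → t ≤ t') →
    lam ≤ t + |q 1 - R.c j 1| * |((R.dir (g a) 0 + R.dir (g a - 1) 0 : ℤ) : ℝ)|

/-- The polytope `𝒫̃_ST` of admissible size tuples:
`sz a ≥ 0`, `sz a + sz (a+1) ≤ ℓ_a` and `sz a ≤ α_a` for all `a` (cyclically). -/
def STPolytope {d m D : ℕ} [NeZero d] [NeZero D] (R : STRep d m)
    (g : Fin D → Fin d) : Set (Fin D → ℝ) :=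
  {sz | ∀ a, 0 ≤ sz a ∧ sz a + sz (a + 1) ≤ stEdgeLen R g a ∧ AlphaBound R g a (sz a)}

section PackedTriangle

lemma sl2Apply_zero_coord (M : Matrix.SpecialLinearGroup (Fin 2) ℤ) (x : Pt) :
    sl2Apply M x 0 = (M 0 0 : ℝ) * x 0 + (M 0 1 : ℝ) * x 1 := by
  simp [sl2Apply, Matrix.mulVec, dotProduct, Fin.sum_univ_two]

lemma sl2Apply_one_coord (M : Matrix.SpecialLinearGroup (Fin 2) ℤ) (x : Pt) :
    sl2Apply M x 1 = (M 1 0 : ℝ) * x 0 + (M 1 1 : ℝ) * x 1 := by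
  simp [sl2Apply, Matrix.mulVec, dotProduct, Fin.sum_univ_two]

lemma sl2Apply_smul (M : Matrix.SpecialLinearGroup (Fin 2) ℤ) (k : ℝ) (x : Pt) :
    sl2Apply M (k • x) = k • sl2Apply M x :=
  Matrix.mulVec_smul _ _ _

lemma sl2Apply_add (M : Matrix.SpecialLinearGroup (Fin 2) ℤ) (x y : Pt) :
    sl2Apply M (x + y) = sl2Apply M x + sl2Apply M y :=
  Matrix.mulVec_add _ _ _

lemma continuous_sl2Apply (M : Matrix.SpecialLinearGroup (Fin 2) ℤ) :
    Continuous (sl2Apply M) := by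
  unfold sl2Apply
  fun_prop

lemma sl2Apply_det (M : Matrix.SpecialLinearGroup (Fin 2) ℤ) :
    (M 0 0 : ℝ) * M 1 1 - (M 0 1 : ℝ) * M 1 0 = 1 := by
  have h := M.det_coe
  rw [Matrix.det_fin_two] at h
  exact_mod_cast h

lemma sl2Apply_injective (M : Matrix.SpecialLinearGroup (Fin 2) ℤ) :
    Function.Injective (sl2Apply M) := by
  intro x y h
  have h0 := congrFun h 0
  have h1 := congrFun h 1
  rw [sl2Apply_zero_coord, sl2Apply_zero_coord] at h0
  rw [sl2Apply_one_coord, sl2Apply_one_coord] at h1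
  have hd := sl2Apply_det M
  ext i
  fin_cases i
  · change x 0 = y 0
    linear_combination (M 1 1 : ℝ) * h0 - (M 0 1 : ℝ) * h1 - (x 0 - y 0) * hd
  · change x 1 = y 1
    linear_combination (M 0 0 : ℝ) * h1 - (M 1 0 : ℝ) * h0 - (x 1 - y 1) * hd

/-- The vertical displacement of `stMap` at abscissa `x`. -/
noncomputable def stShear {m : ℕ} (c : Fin m → Pt) (n : ℤ) (t : ℝ) (u : Fin m → ℤ)
    (x : ℝ) : ℝ :=
  (n : ℝ) * x + t + ∑ j, (u j : ℝ) * max (x - c j 0) 0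

variable {m : ℕ} (c : Fin m → Pt) (n : ℤ) (t : ℝ) (u : Fin m → ℤ)

lemma stMap_zero_coord (x : Pt) : stMap c n t u x 0 = x 0 := rfl

lemma stMap_one_coord (x : Pt) : stMap c n t u x 1 = x 1 + stShear c n t u (x 0) := by
  simp [stMap, stShear, add_assoc]

lemma continuous_stShear : Continuous (stShear c n t u) := by
  unfold stShear
  fun_prop

lemma continuous_stMap : Continuous (stMap c n t u) := by
  refine continuous_pi fun i => ?_
  have := continuous_stShear c n t u
  fin_cases i
  · exact continuous_apply 0
  · change Continuous fun x : Pt => stMap c n t u x 1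
    simp only [stMap_one_coord]
    fun_prop

/-- The inverse of `stMap`. -/
noncomputable def stMapInv (x : Pt) : Pt := ![x 0, x 1 - stShear c n t u (x 0)]

lemma continuous_stMapInv : Continuous (stMapInv c n t u) := by
  refine continuous_pi fun i => ?_
  have := continuous_stShear c n t u
  fin_cases i
  · exact continuous_apply 0
  · change Continuous fun x : Pt => x 1 - stShear c n t u (x 0)
    fun_prop

lemma stMapInv_stMap (x : Pt) : stMapInv c n t u (stMap c n t u x) = x := by
  ext i
  fin_cases i
  · rfl
  · change stMap c n t u x 1 - stShear c n t u (x 0) = x 1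
    rw [stMap_one_coord]
    ring

lemma stMap_stMapInv (x : Pt) : stMap c n t u (stMapInv c n t u x) = x := by
  ext i
  fin_cases i
  · rfl
  · change stMap c n t u (stMapInv c n t u x) 1 = x 1
    rw [stMap_one_coord]
    change x 1 - stShear c n t u (x 0) + stShear c n t u (x 0) = x 1
    ring

/-- `stShear` is affine with integer slope on a half-line bounded by the marked points. -/
lemma exists_stShear_affine (a : ℤ) (ha : a = 1 ∨ a = -1) :
    ∃ N : ℤ, ∀ x₀ r : ℝ, 0 ≤ r → (∀ j, r ≤ a * (c j 0 - x₀)) →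
      ∀ x, a * (x - x₀) ≤ r →
        stShear c n t u x = stShear c n t u x₀ + N * (x - x₀) := by
  rcases ha with rfl | rfl
  · refine ⟨n, fun x₀ r hr hc x hx => ?_⟩
    push_cast at hc hx
    have key : ∀ y : ℝ, y - x₀ ≤ r → stShear c n t u y = n * y + t := by
      intro y hy
      rw [stShear, Finset.sum_eq_zero, add_zero]
      intro j _
      rw [max_eq_right (by linarith [hc j]), mul_zero]
    rw [key x (by linarith), key x₀ (by linarith)]
    ring
  · refine ⟨n + ∑ j, u j, fun x₀ r hr hc x hx => ?_⟩
    push_cast at hc hx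
    have key : ∀ y : ℝ, -(y - x₀) ≤ r →
        stShear c n t u y = n * y + t + ((∑ j, (u j : ℝ)) * y - ∑ j, (u j : ℝ) * c j 0) := by
      intro y hy
      rw [stShear, Finset.sum_mul, ← Finset.sum_sub_distrib]
      congr 1
      refine Finset.sum_congr rfl fun j _ => ?_
      rw [max_eq_left (by linarith [hc j])]
      ring
    rw [key x (by linarith), key x₀ (by linarith)]
    push_cast
    ring

lemma mem_closure_modelTriangle {lam : ℝ} (hlam : 0 < lam) {y : Pt} (h0 : 0 ≤ y 0)
    (h1 : 0 ≤ y 1) (h : y 0 + y 1 ≤ lam) : y ∈ closure (modelTriangle lam) := by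
  have hc : ContinuousWithinAt (fun s : ℝ => s • y) (Set.Ico 0 1) 1 := by fun_prop
  have := hc.mem_closure_image (s := Set.Ico (0 : ℝ) 1)
    (by rw [closure_Ico (by norm_num)]; simp)
  rw [one_smul] at this
  refine closure_mono ?_ this
  rintro _ ⟨s, ⟨hs0, hs1⟩, rfl⟩
  refine ⟨mul_nonneg hs0 h0, mul_nonneg hs0 h1, ?_⟩
  change s * y 0 + s * y 1 < lam
  nlinarith

lemma convex_modelTriangle (lam : ℝ) : Convex ℝ (modelTriangle lam) := by
  rintro x ⟨hx0, hx1, hx⟩ y ⟨hy0, hy1, hy⟩ a b ha hb hab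
  refine ⟨?_, ?_, ?_⟩
  · change 0 ≤ a * x 0 + b * y 0
    positivity
  · change 0 ≤ a * x 1 + b * y 1
    positivity
  · change a * x 0 + b * y 0 + (a * x 1 + b * y 1) < lam
    obtain rfl : b = 1 - a := by linarith
    rcases ha.eq_or_lt with rfl | ha'
    · linarith
    · nlinarith

/-- The closure of an `SL₂(ℤ)`-image of the model triangle is a closed triangle. -/
lemma closure_image_modelTriangle {lam : ℝ} (hlam : 0 < lam)
    (M : Matrix.SpecialLinearGroup (Fin 2) ℤ) (p : Pt) :
    closure ((fun x => sl2Apply M x + p) '' modelTriangle lam) =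
      convexHull ℝ {p, sl2Apply M ![lam, 0] + p, sl2Apply M ![0, lam] + p} := by
  have hcont : Continuous fun x => sl2Apply M x + p :=
    (continuous_sl2Apply M).add continuous_const
  have hconv : Convex ℝ ((fun x => sl2Apply M x + p) '' modelTriangle lam) := by
    have := ((convex_modelTriangle lam).is_linear_image
      (f := sl2Apply M) ⟨sl2Apply_add M, sl2Apply_smul M⟩).translate p
    rw [Set.image_image] at this
    simpa only [add_comm p] using this
  have hcl : ∀ y : Pt, 0 ≤ y 0 → 0 ≤ y 1 → y 0 + y 1 ≤ lam →
      sl2Apply M y + p ∈ closure ((fun x => sl2Apply M x + p) '' modelTriangle lam) :=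
    fun y h0 h1 h => image_closure_subset_closure_image hcont
      ⟨y, mem_closure_modelTriangle hlam h0 h1 h, rfl⟩
  have hzero : sl2Apply M 0 = 0 := Matrix.mulVec_zero _
  apply Set.Subset.antisymm
  · refine closure_minimal ?_ (Set.Finite.isClosed_convexHull ℝ (Set.toFinite _))
    rintro _ ⟨y, ⟨h0, h1, h⟩, rfl⟩
    have hcx := convex_convexHull ℝ
      ({p, sl2Apply M ![lam, 0] + p, sl2Apply M ![0, lam] + p} : Set Pt)
    have hsub := subset_convexHull ℝ
      ({p, sl2Apply M ![lam, 0] + p, sl2Apply M ![0, lam] + p} : Set Pt)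
    have := hcx.sum_mem (t := Finset.univ)
      (w := ![1 - (y 0 + y 1) / lam, y 0 / lam, y 1 / lam])
      (z := ![p, sl2Apply M ![lam, 0] + p, sl2Apply M ![0, lam] + p]) ?_ ?_ ?_
    · convert this using 1
      rw [Fin.sum_univ_three]
      ext i
      fin_cases i
      · simp [sl2Apply_zero_coord]
        field_simp
        ring
      · simp [sl2Apply_one_coord]
        field_simp
        ring
    · intro i _
      fin_cases i
      · change 0 ≤ 1 - (y 0 + y 1) / lam
        rw [sub_nonneg, div_le_one hlam]
        exact h.le
      · change 0 ≤ y 0 / lam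
        positivity
      · change 0 ≤ y 1 / lam
        positivity
    · simp [Fin.sum_univ_three]
      ring
    · intro i _
      fin_cases i <;> exact hsub (by simp)
  · refine convexHull_min ?_ hconv.closure
    rintro x (rfl | rfl | rfl)
    · simpa [hzero] using hcl 0 le_rfl le_rfl (by simpa using hlam.le)
    · exact hcl _ hlam.le le_rfl (by simp)
    · exact hcl _ le_rfl hlam.le (by simp)

end PackedTriangle

/-- If `B` is an admissibly packed triangle at a vertex `p` of a
semitoric polygon representative such that `e = closure B \ B` is a vertical line
segment, then `B` meets no cut of the polygon (so `B` is an actual triangle of the form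
`M(B(λ)) + p` with `M ∈ SL₂(ℤ)`), and the two edges of `B` other than `e` have integer
slopes which differ by exactly one. -/
theorem stmt18 {d m : ℕ} [NeZero d] (R : STRep d m) (hR : R.IsValid)
    (p : Pt) (hp : ∃ i, p = R.V i) (lam : ℝ) (B : Set Pt)
    (hB : IsSTPackedTriangle R p lam B)
    (hvert : ∃ z₁ z₂ : Pt, z₁ ≠ z₂ ∧ z₁ 0 = z₂ 0 ∧
        closure B \ B = segment ℝ z₁ z₂) :
    (∀ (j : Fin m) (x : Pt), x ∈ B →
        ¬(x 0 = R.c j 0 ∧ 0 ≤ (R.eps j : ℝ) * (x 1 - R.c j 1))) ∧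
    (∃ M : Matrix.SpecialLinearGroup (Fin 2) ℤ,
        B = (fun x => sl2Apply M x + p) '' modelTriangle lam) ∧
    (∃ (q₁ q₂ : Pt) (s₁ s₂ : ℤ),
        closure B = convexHull ℝ {p, q₁, q₂} ∧ q₁ 0 = q₂ 0 ∧ q₁ ≠ q₂ ∧
        q₁ 1 - p 1 = (s₁ : ℝ) * (q₁ 0 - p 0) ∧
        q₂ 1 - p 1 = (s₂ : ℝ) * (q₂ 0 - p 0) ∧
        (s₂ = s₁ + 1 ∨ s₁ = s₂ + 1)) := by
  obtain ⟨hlam, -, hcB, n, t, u, -, ⟨M, hM⟩, U, hUo, hpU, hU⟩ := hB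
  have hcontS := continuous_stMap R.c n t u
  have hinvS : Function.LeftInverse (stMapInv R.c n t u) (stMap R.c n t u) :=
    stMapInv_stMap R.c n t u
  set σ := stMap R.c n t u with hσ
  have hΔ : Convex ℝ R.carrier := convex_convexHull ℝ _
  have hpΔ : p ∈ R.carrier := by
    obtain ⟨i, rfl⟩ := hp
    exact subset_convexHull ℝ _ ⟨i, rfl⟩
  have hcΔ : ∀ j, R.c j ∈ R.carrier := fun j => interior_subset (hR.marked_interior j)
  -- The hypotenuse is vertical, so the first row of `M` is `(a, a)` with `a = ±1`.
  have hcol : M 0 0 = M 0 1 := by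
    obtain ⟨z₁, z₂, -, hz, he⟩ := hvert
    have hBimg : B = (fun x => stMapInv R.c n t u (sl2Apply M x + σ p)) '' modelTriangle lam := by
      rw [← hinvS.image_image B, hM, Set.image_image]
    have hcont : Continuous fun x => stMapInv R.c n t u (sl2Apply M x + σ p) :=
      (continuous_stMapInv R.c n t u).comp ((continuous_sl2Apply M).add continuous_const)
    have habs : ∀ y : Pt, 0 ≤ y 0 → 0 ≤ y 1 → y 0 + y 1 = lam →
        sl2Apply M y 0 + p 0 = z₁ 0 := by
      intro y h0 h1 h
      have hmem : stMapInv R.c n t u (sl2Apply M y + σ p) ∈ closure B \ B := by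
        constructor
        · rw [hBimg]
          exact image_closure_subset_closure_image hcont
            ⟨y, mem_closure_modelTriangle hlam h0 h1 h.le, rfl⟩
        · intro hmem
          have h2 := Set.mem_image_of_mem σ hmem
          rw [hM, hσ, stMap_stMapInv] at h2
          obtain ⟨y', hy', he'⟩ := h2
          obtain rfl := sl2Apply_injective M (add_right_cancel he')
          exact absurd hy'.2.2 (by simp [h])
      rw [he] at hmem
      obtain ⟨a, b, -, -, hab, hx⟩ := hmem
      have hx0 : a * z₁ 0 + b * z₂ 0 = sl2Apply M y 0 + p 0 := congrFun hx 0
      rw [← hx0, ← hz, ← add_mul, hab, one_mul]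
    have e1 := habs ![lam, 0] hlam.le le_rfl (by simp)
    have e2 := habs ![0, lam] le_rfl hlam.le (by simp)
    rw [sl2Apply_zero_coord] at e1 e2
    simp at e1 e2
    have : (M 0 0 : ℝ) * lam = (M 0 1 : ℝ) * lam := by linarith
    exact_mod_cast mul_right_cancel₀ hlam.ne' this
  obtain ⟨a, ha⟩ : ∃ a, a = M 0 0 := ⟨_, rfl⟩
  have hdet : a * (M 1 1 - M 1 0) = 1 := by
    have h := M.det_coe
    rw [Matrix.det_fin_two] at h
    rw [ha]
    linear_combination h - M 1 0 * hcol
  have ha1 : a = 1 ∨ a = -1 := Int.isUnit_iff.1 (IsUnit.of_mul_eq_one _ hdet)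
  have haa : (a : ℝ) * a = 1 := by rcases ha1 with h | h <;> simp [h]
  have hM0 : ∀ y : Pt, sl2Apply M y 0 = a * (y 0 + y 1) := by
    intro y
    rw [sl2Apply_zero_coord, ← hcol, ← ha]
    ring
  have hBmem : ∀ x, x ∈ B ↔ ∃ y ∈ modelTriangle lam, sl2Apply M y + σ p = σ x := by
    intro x
    rw [← hinvS.injective.mem_set_image, hM]
    rfl
  -- Points of the polygon on the segment from `p` towards `q`, close to `p`, lie in `B`.
  have hnear : ∀ q ∈ R.carrier, ∃ ε : ℝ, 0 < ε ∧ ε ≤ 1 ∧ ∃ y : Pt, 0 ≤ y 0 ∧ 0 ≤ y 1 ∧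
      sl2Apply M y + σ p = σ (p + ε • (q - p)) := by
    intro q hq
    have hc : Continuous fun s : ℝ => σ (p + s • (q - p)) := hcontS.comp (by fun_prop)
    have hev : ∀ᶠ s : ℝ in nhds 0, σ (p + s • (q - p)) ∈ U :=
      hc.continuousAt.eventually_mem (hUo.mem_nhds (by simpa using hpU))
    obtain ⟨δ, hδ, hball⟩ := Metric.eventually_nhds_iff.1 hev
    have hmin : 0 < min (δ / 2) 1 := by positivity
    refine ⟨min (δ / 2) 1, hmin, min_le_right _ _, ?_⟩
    have hinU := hball (y := min (δ / 2) 1) (by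
      rw [Real.dist_0_eq_abs, abs_of_pos hmin]
      exact (min_le_left _ _).trans_lt (by linarith))
    have hinΔ := hΔ.add_smul_sub_mem hpΔ hq ⟨hmin.le, min_le_right _ _⟩
    have := hU.ge ⟨Set.mem_image_of_mem σ hinΔ, hinU⟩
    rw [hM] at this
    obtain ⟨⟨y, hy, he⟩, -⟩ := this
    exact ⟨y, hy.1, hy.2.1, he⟩
  have hside : ∀ q ∈ R.carrier, 0 ≤ (a : ℝ) * (q 0 - p 0) := by
    intro q hq
    obtain ⟨ε, hε, hε1, y, h0, h1, he⟩ := hnear q hq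
    have he0 : sl2Apply M y 0 + p 0 = p 0 + ε * (q 0 - p 0) := congrFun he 0
    rw [hM0] at he0
    have : ε * ((a : ℝ) * (q 0 - p 0)) = y 0 + y 1 := by
      linear_combination (y 0 + y 1) * haa - (a : ℝ) * he0
    exact nonneg_of_mul_nonneg_right (by rw [this]; positivity) hε
  obtain ⟨N, hN⟩ := exists_stShear_affine R.c n t u a ha1
  have hfar : ∀ j, lam ≤ (a : ℝ) * (R.c j 0 - p 0) := by
    by_contra! hcon
    obtain ⟨j₀, hj₀⟩ := hcon
    have : Nonempty (Fin m) := ⟨j₀⟩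
    obtain ⟨j, hj⟩ := Finite.exists_min fun j => (a : ℝ) * (R.c j 0 - p 0)
    have hjlam := (hj j₀).trans_lt hj₀
    have haff := hN (p 0) _ (hside _ (hcΔ j)) hj
    obtain ⟨ε, hε, hε1, y, h0, h1, he⟩ := hnear _ (hcΔ j)
    have he0 : sl2Apply M y 0 + p 0 = p 0 + ε * (R.c j 0 - p 0) := congrFun he 0
    have he1 := congrFun he 1
    rw [Pi.add_apply, hσ, stMap_one_coord, stMap_one_coord] at he1
    have hsum : y 0 + y 1 = ε * ((a : ℝ) * (R.c j 0 - p 0)) := by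
      rw [hM0] at he0
      linear_combination (a : ℝ) * he0 - (y 0 + y 1) * haa
    have hle : (a : ℝ) * ((p + ε • (R.c j - p)) 0 - p 0) ≤ (a : ℝ) * (R.c j 0 - p 0) := by
      have := hside _ (hcΔ j)
      simp only [Pi.add_apply, Pi.smul_apply, Pi.sub_apply, smul_eq_mul]
      nlinarith
    rw [haff _ hle] at he1
    simp only [Pi.add_apply, Pi.smul_apply, Pi.sub_apply, smul_eq_mul] at he1
    refine hcB j ((hBmem _).2 ⟨ε⁻¹ • y, ⟨?_, ?_, ?_⟩, ?_⟩)
    · change 0 ≤ ε⁻¹ * y 0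
      positivity
    · change 0 ≤ ε⁻¹ * y 1
      positivity
    · change ε⁻¹ * y 0 + ε⁻¹ * y 1 < lam
      rwa [← mul_add, hsum, inv_mul_cancel_left₀ hε.ne']
    · rw [sl2Apply_smul]
      ext i
      fin_cases i
      · change ε⁻¹ * sl2Apply M y 0 + p 0 = R.c j 0
        rw [eq_sub_of_add_eq he0]
        field_simp
        ring
      · change ε⁻¹ * sl2Apply M y 1 + σ p 1 = σ (R.c j) 1
        rw [hσ, stMap_one_coord, stMap_one_coord, haff _ le_rfl, eq_sub_of_add_eq he1]
        field_simp
        ring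
  have haffB := hN (p 0) lam hlam.le hfar
  have hB0 : ∀ x ∈ B, (a : ℝ) * (x 0 - p 0) < lam := by
    intro x hx
    obtain ⟨y, hy, he⟩ := (hBmem x).1 hx
    have he0 : sl2Apply M y 0 + p 0 = x 0 := congrFun he 0
    rw [hM0] at he0
    have : (a : ℝ) * (x 0 - p 0) = y 0 + y 1 := by
      linear_combination (y 0 + y 1) * haa - (a : ℝ) * he0
    rw [this]
    exact hy.2.2
  let M' : Matrix.SpecialLinearGroup (Fin 2) ℤ :=
    ⟨!![a, a; M 1 0 - N * a, M 1 1 - N * a], by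
      rw [Matrix.det_fin_two_of]
      linear_combination hdet⟩
  have hM'0 : ∀ y : Pt, sl2Apply M' y 0 = a * (y 0 + y 1) := by
    intro y
    rw [sl2Apply_zero_coord]
    simp [M']
    ring
  have hM'1 : ∀ y : Pt, sl2Apply M' y 1 = sl2Apply M y 1 - N * (a * (y 0 + y 1)) := by
    intro y
    rw [sl2Apply_one_coord, sl2Apply_one_coord]
    simp [M']
    ring
  have hunshear : ∀ x ∈ B, ∀ y : Pt, sl2Apply M y + σ p = σ x → sl2Apply M' y + p = x := by
    intro x hx y he
    have he0 : sl2Apply M y 0 + p 0 = x 0 := congrFun he 0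
    have he1 := congrFun he 1
    rw [Pi.add_apply, hσ, stMap_one_coord, stMap_one_coord, haffB _ (hB0 x hx).le] at he1
    rw [hM0] at he0
    ext i
    fin_cases i
    · change sl2Apply M' y 0 + p 0 = x 0
      rw [hM'0, he0]
    · change sl2Apply M' y 1 + p 1 = x 1
      rw [hM'1]
      linear_combination he1 - (N : ℝ) * he0
  have hBeq : B = (fun x => sl2Apply M' x + p) '' modelTriangle lam := by
    ext x
    constructor
    · intro hx
      obtain ⟨y, hy, he⟩ := (hBmem x).1 hx
      exact ⟨y, hy, hunshear x hx y he⟩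
    · rintro ⟨y, hy, rfl⟩
      have hmem : sl2Apply M y + σ p ∈ σ '' B := by
        rw [hM]
        exact ⟨y, hy, rfl⟩
      obtain ⟨b, hb, he⟩ := hmem
      change sl2Apply M' y + p ∈ B
      rwa [hunshear b hb y he.symm]
  refine ⟨fun j x hx h => ?_, ⟨M', hBeq⟩, ?_⟩
  · have h1 := hB0 x hx
    rw [h.1] at h1
    exact absurd (hfar j) (not_le.2 h1)
  have hdet' : (a : ℝ) * (M 1 1 - M 1 0) = 1 := by exact_mod_cast hdet
  refine ⟨sl2Apply M' ![lam, 0] + p, sl2Apply M' ![0, lam] + p,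
    a * (M 1 0 - N * a), a * (M 1 1 - N * a),
    hBeq ▸ closure_image_modelTriangle hlam M' p, ?_, ?_, ?_, ?_, ?_⟩
  · simp [hM'0]
  · intro h
    have h1 := congrFun (sl2Apply_injective M' (add_right_cancel h)) 0
    exact hlam.ne' h1
  · simp [hM'0, hM'1, sl2Apply_one_coord]
    linear_combination -(lam * (M 1 0 - N * a)) * haa
  · simp [hM'0, hM'1, sl2Apply_one_coord]
    linear_combination -(lam * (M 1 1 - N * a)) * haa
  · left
    linear_combination hdet
end
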